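/- There exists ε₀ > 0 such that for every ε ∈ (0, ε₀) there exists n₀ such that the following holds for all n ≥ n₀. Let G be a coloured graph on a vertex set V of n vertices with c(G) ≥ f(n) − ε²n³. Then there exist a coloured graph G' on V and a set Q ⊆ V such that: c(G') ≥ c(G); G and G' differ on at most 800·ε^{1/2}·n² pairs; | |Q| − βn | ≤ 100εn; every pair of distinct vertices of Q is blue in G'; and every pair {q,v} with q ∈ Q and v ∉ Q is red in G' and directed from v to q. -/

import Mathlib

/-- `f 0 = f 1 = 0` and, for `n ≥ 2`,
`f n = max over 1 ≤ k ≤ n − 1 of (k choose 2)·(n − k) + f (n − k)`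
(here `k = j + 1` ranges over `1, …, n − 1`). -/
def f : ℕ → ℕ
  | 0 => 0
  | 1 => 0
  | n + 2 =>
    (Finset.range (n + 1)).sup fun j =>
      Nat.choose (j + 1) 2 * (n + 1 - j) + f (n + 1 - j)
  decreasing_by omega
/-- A coloured graph on `V`: every pair of distinct vertices is either blue, or red with
an orientation (`Red x y` means red, directed from `x` to `y`). -/
structure ColouredGraph (V : Type) where
  Blue : V → V → Prop
  Red : V → V → Prop
  blue_symm : ∀ x y, Blue x y → Blue y x
  trichotomy : ∀ x y : V, x ≠ y →
    (Blue x y ∧ ¬ Red x y ∧ ¬ Red y x) ∨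
    (¬ Blue x y ∧ Red x y ∧ ¬ Red y x) ∨
    (¬ Blue x y ∧ ¬ Red x y ∧ Red y x)

/-- A cherry of `G`: a 3-element set `{x, y, z}` with `Red x y`, `Red x z` and `Blue y z`. -/
def IsCherry {V : Type} [DecidableEq V] (G : ColouredGraph V) (e : Finset V) : Prop :=
  ∃ x y z : V, x ≠ y ∧ x ≠ z ∧ y ≠ z ∧ e = ({x, y, z} : Finset V) ∧
    G.Red x y ∧ G.Red x z ∧ G.Blue y z

/-- `c(G)`, the number of cherries of `G`. -/
noncomputable def cherryCount {V : Type} [DecidableEq V] (G : ColouredGraph V) : ℕ :=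
  Set.ncard {e : Finset V | IsCherry G e}
/-- The set of (unordered) pairs on which the coloured graphs `G` and `G'` differ,
i.e. the pair does not get the same colour (with the same orientation, if red) in both. -/
def diffPairs {V : Type} [DecidableEq V] (G G' : ColouredGraph V) : Set (Finset V) :=
  { e | ∃ x y : V, x ≠ y ∧ e = ({x, y} : Finset V) ∧
      ¬ ((G.Blue x y ↔ G'.Blue x y) ∧ (G.Red x y ↔ G'.Red x y) ∧ (G.Red y x ↔ G'.Red y x)) }


section Helpers

set_option linter.unusedSectionVars false

open Finset

variable {V : Type} [Fintype V] [DecidableEq V]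

open Classical in
/-- Indicator of a red pair directed from `x` to `y`. -/
noncomputable def rr (G : ColouredGraph V) (x y : V) : ℝ := if x ≠ y ∧ G.Red x y then 1 else 0

open Classical in
/-- Indicator of a blue pair. -/
noncomputable def bb (G : ColouredGraph V) (x y : V) : ℝ := if x ≠ y ∧ G.Blue x y then 1 else 0

lemma rr_nonneg (G : ColouredGraph V) (x y : V) : 0 ≤ rr G x y := by
  unfold rr; split_ifs <;> norm_num

lemma bb_nonneg (G : ColouredGraph V) (x y : V) : 0 ≤ bb G x y := by
  unfold bb; split_ifs <;> norm_num

lemma rr_le_one (G : ColouredGraph V) (x y : V) : rr G x y ≤ 1 := by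
  unfold rr; split_ifs <;> norm_num

lemma bb_le_one (G : ColouredGraph V) (x y : V) : bb G x y ≤ 1 := by
  unfold bb; split_ifs <;> norm_num

lemma rr_zero_or_one (G : ColouredGraph V) (x y : V) : rr G x y = 0 ∨ rr G x y = 1 := by
  unfold rr; split_ifs <;> simp

lemma bb_zero_or_one (G : ColouredGraph V) (x y : V) : bb G x y = 0 ∨ bb G x y = 1 := by
  unfold bb; split_ifs <;> simp

@[simp] lemma rr_self (G : ColouredGraph V) (x : V) : rr G x x = 0 := by simp [rr]

@[simp] lemma bb_self (G : ColouredGraph V) (x : V) : bb G x x = 0 := by simp [bb]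

lemma bb_comm (G : ColouredGraph V) (x y : V) : bb G x y = bb G y x := by
  unfold bb
  have : (x ≠ y ∧ G.Blue x y) ↔ (y ≠ x ∧ G.Blue y x) :=
    ⟨fun h => ⟨h.1.symm, G.blue_symm _ _ h.2⟩, fun h => ⟨h.1.symm, G.blue_symm _ _ h.2⟩⟩
  by_cases h : x ≠ y ∧ G.Blue x y
  · rw [if_pos h, if_pos (this.1 h)]
  · rw [if_neg h, if_neg (fun h' => h (this.2 h'))]

lemma tri (G : ColouredGraph V) {x y : V} (h : x ≠ y) : bb G x y + rr G x y + rr G y x = 1 := by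
  unfold bb rr
  rcases G.trichotomy x y h with h1 | h1 | h1 <;> simp [h, h.symm, h1]

/-- Twice the number of cherries, as a sum over ordered triples. -/
noncomputable def c2 (G : ColouredGraph V) : ℝ :=
  ∑ x, ∑ y, ∑ z, rr G x y * rr G x z * bb G y z

/-- Partial sums of `c2`. -/
noncomputable def S3 (G : ColouredGraph V) (A B C : Finset V) : ℝ :=
  ∑ x ∈ A, ∑ y ∈ B, ∑ z ∈ C, rr G x y * rr G x z * bb G y z

lemma S3_swap (G : ColouredGraph V) (A B C : Finset V) : S3 G A B C = S3 G A C B := by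
  unfold S3
  refine Finset.sum_congr rfl fun x _ => ?_
  rw [Finset.sum_comm]
  refine Finset.sum_congr rfl fun y _ => Finset.sum_congr rfl fun z _ => ?_
  rw [bb_comm G y z]; ring

lemma S3_nonneg (G : ColouredGraph V) (A B C : Finset V) : 0 ≤ S3 G A B C := by
  unfold S3
  refine Finset.sum_nonneg fun x _ => Finset.sum_nonneg fun y _ => Finset.sum_nonneg fun z _ => ?_
  have := rr_nonneg G x y; have := rr_nonneg G x z; have := bb_nonneg G y z
  positivity

lemma sum_split (Q : Finset V) (F : V → ℝ) : ∑ x, F x = ∑ x ∈ Q, F x + ∑ x ∈ Qᶜ, F x :=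
  (Finset.sum_add_sum_compl Q F).symm

lemma c2_split (G : ColouredGraph V) (Q : Finset V) :
    c2 G = S3 G Qᶜ Q Q + S3 G Qᶜ Qᶜ Qᶜ + 2 * S3 G Qᶜ Q Qᶜ
      + S3 G Q Q Q + 2 * S3 G Q Q Qᶜ + S3 G Q Qᶜ Qᶜ := by
  have h1 := S3_swap G Qᶜ Q Qᶜ
  have h2 := S3_swap G Q Q Qᶜ
  have : c2 G = S3 G Qᶜ Q Q + S3 G Qᶜ Qᶜ Qᶜ + (S3 G Qᶜ Q Qᶜ + S3 G Qᶜ Qᶜ Q)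
      + S3 G Q Q Q + (S3 G Q Q Qᶜ + S3 G Q Qᶜ Q) + S3 G Q Qᶜ Qᶜ := by
    unfold c2 S3
    rw [sum_split Q]
    simp only [sum_split Q, Finset.sum_add_distrib]
    ring
  rw [this]; linarith

lemma cherry_unique (G : ColouredGraph V) {x y z a b c : V} (hxy : x ≠ y) (hxz : x ≠ z)
    (hyz : y ≠ z) (h1 : G.Red x y) (h2 : G.Red x z) (h3 : G.Blue y z)
    (ha : a = x ∨ a = y ∨ a = z) (hb : b = x ∨ b = y ∨ b = z) (hc : c = x ∨ c = y ∨ c = z)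
    (h4 : a ≠ b) (h5 : G.Red a b) (h6 : a ≠ c) (h7 : G.Red a c) (h8 : b ≠ c) (h9 : G.Blue b c) :
    a = x ∧ b = y ∧ c = z ∨ a = x ∧ b = z ∧ c = y := by
  have t1 := G.trichotomy x y hxy
  have t2 := G.trichotomy x z hxz
  have hax : a = x := by
    rcases ha with h | h | h
    · exact h
    · subst h
      rcases hb with h | h | h <;> subst h
      · exact absurd h5 (by tauto)
      · exact absurd rfl h4
      · have := G.trichotomy a b hyz
        exact absurd h5 (by tauto)
    · subst h
      rcases hb with h | h | h <;> subst h
      · exact absurd h5 (by tauto)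
      · have := G.trichotomy b a hyz
        exact absurd h5 (by tauto)
      · exact absurd rfl h4
  subst hax
  have hb' : b = y ∨ b = z := by
    rcases hb with h | h | h
    · exact absurd h.symm h4
    · exact Or.inl h
    · exact Or.inr h
  have hc' : c = y ∨ c = z := by
    rcases hc with h | h | h
    · exact absurd h.symm h6
    · exact Or.inl h
    · exact Or.inr h
  rcases hb' with h | h <;> rcases hc' with h' | h' <;> subst h <;> subst h'
  · exact absurd rfl h8
  · exact Or.inl ⟨rfl, rfl, rfl⟩
  · exact Or.inr ⟨rfl, rfl, rfl⟩
  · exact absurd rfl h8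

lemma c2_eq (G : ColouredGraph V) : c2 G = 2 * (cherryCount G : ℝ) := by
  classical
  set T : Finset (V × V × V) := univ.filter fun p =>
    (p.1 ≠ p.2.1 ∧ G.Red p.1 p.2.1) ∧ (p.1 ≠ p.2.2 ∧ G.Red p.1 p.2.2) ∧
      (p.2.1 ≠ p.2.2 ∧ G.Blue p.2.1 p.2.2) with hT
  have h1 : c2 G = (T.card : ℝ) := by
    rw [hT, Finset.card_filter]
    push_cast
    rw [Fintype.sum_prod_type]
    unfold c2
    refine Finset.sum_congr rfl fun x _ => ?_
    rw [Fintype.sum_prod_type]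
    refine Finset.sum_congr rfl fun y _ => Finset.sum_congr rfl fun z _ => ?_
    unfold rr bb
    by_cases a : x ≠ y ∧ G.Red x y <;> by_cases b : x ≠ z ∧ G.Red x z <;>
      by_cases c : y ≠ z ∧ G.Blue y z <;> simp [a, b, c]
  set C : Finset (Finset V) := univ.filter fun e => IsCherry G e with hC
  have h2 : cherryCount G = C.card := by
    unfold cherryCount
    rw [← Set.ncard_coe_finset]; congr 1; ext e; simp [hC]
  have h3 : T.card = C.card * 2 := by
    have hmap : ∀ p ∈ T, (({p.1, p.2.1, p.2.2} : Finset V)) ∈ C := by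
      rintro ⟨x, y, z⟩ hp
      simp only [hT, Finset.mem_filter, Finset.mem_univ, true_and] at hp
      simp only [hC, Finset.mem_filter, Finset.mem_univ, true_and]
      exact ⟨x, y, z, hp.1.1, hp.2.1.1, hp.2.2.1, rfl, hp.1.2, hp.2.1.2, hp.2.2.2⟩
    rw [Finset.card_eq_sum_card_fiberwise
      (f := fun p : V × V × V => (({p.1, p.2.1, p.2.2} : Finset V))) (t := C) hmap]
    refine Finset.sum_const_nat fun e he => ?_
    simp only [hC, Finset.mem_filter, Finset.mem_univ, true_and] at he
    obtain ⟨x, y, z, hxy, hxz, hyz, rfl, h1, h2, h3⟩ := he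
    have : (T.filter fun p => ({p.1, p.2.1, p.2.2} : Finset V) = {x, y, z})
        = {(x, y, z), (x, z, y)} := by
      ext ⟨a, b, c⟩
      simp only [hT, Finset.mem_filter, Finset.mem_univ, true_and, Finset.mem_insert,
        Finset.mem_singleton, Prod.mk.injEq]
      constructor
      · rintro ⟨⟨⟨h4, h5⟩, ⟨h6, h7⟩, h8, h9⟩, h10⟩
        have ha : a ∈ ({x, y, z} : Finset V) := by rw [← h10]; simp
        have hb : b ∈ ({x, y, z} : Finset V) := by rw [← h10]; simp
        have hc : c ∈ ({x, y, z} : Finset V) := by rw [← h10]; simp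
        simp only [Finset.mem_insert, Finset.mem_singleton] at ha hb hc
        exact cherry_unique G hxy hxz hyz h1 h2 h3 ha hb hc h4 h5 h6 h7 h8 h9
      · rintro (⟨rfl, rfl, rfl⟩ | ⟨rfl, rfl, rfl⟩)
        · exact ⟨⟨⟨hxy, h1⟩, ⟨hxz, h2⟩, hyz, h3⟩, rfl⟩
        · exact ⟨⟨⟨hxz, h2⟩, ⟨hxy, h1⟩, hyz.symm, G.blue_symm _ _ h3⟩, by
            rw [Finset.pair_comm]⟩
    rw [this, Finset.card_pair]
    simp [hyz]
  rw [h1, h2, h3]; push_cast; ring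

end Helpers

section FBounds

/-- The constant `α`, the asymptotic value of `f n / n ^ 3`. -/
noncomputable def alp : ℝ := (2 * Real.sqrt 3 - 3) / 6

/-- The constant `β`. -/
noncomputable def bet : ℝ := (3 - Real.sqrt 3) / 2

lemma sq3_lo : (1.732 : ℝ) < Real.sqrt 3 := by
  rw [Real.lt_sqrt (by norm_num)]; norm_num

lemma sq3_hi : Real.sqrt 3 < (1.7321 : ℝ) := by
  rw [Real.sqrt_lt' (by norm_num)]; norm_num

lemma f_rec {n k : ℕ} (h1 : 1 ≤ k) (h2 : k < n) :
    Nat.choose k 2 * (n - k) + f (n - k) ≤ f n := by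
  obtain ⟨m, rfl⟩ : ∃ m, n = m + 2 := ⟨n - 2, by omega⟩
  rw [f.eq_3]
  have := Finset.le_sup (s := Finset.range (m + 1))
    (f := fun j => Nat.choose (j + 1) 2 * (m + 1 - j) + f (m + 1 - j)) (b := k - 1)
    (by simp; omega)
  have e1 : k - 1 + 1 = k := by omega
  have e2 : m + 1 - (k - 1) = m + 2 - k := by omega
  rw [e1, e2] at this
  exact this

lemma f_attained (m : ℕ) : ∃ k, 1 ≤ k ∧ k < m + 2 ∧
    f (m + 2) = Nat.choose k 2 * (m + 2 - k) + f (m + 2 - k) := by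
  rw [f.eq_3]
  obtain ⟨j, hj, he⟩ := Finset.exists_mem_eq_sup (Finset.range (m + 1)) ⟨0, by simp⟩
    (fun j => Nat.choose (j + 1) 2 * (m + 1 - j) + f (m + 1 - j))
  rw [Finset.mem_range] at hj
  refine ⟨j + 1, by omega, by omega, ?_⟩
  rw [he]
  have e2 : m + 2 - (j + 1) = m + 1 - j := by omega
  rw [e2]

lemma choose_two_real (k : ℕ) : ((Nat.choose k 2 : ℕ) : ℝ) = (k : ℝ) * (k - 1) / 2 :=
  Nat.cast_choose_two ℝ k

lemma g_identity (k n : ℝ) : k ^ 2 * (n - k) / 2 + alp * (n - k) ^ 3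
    = alp * n ^ 3 - Real.sqrt 3 / 3 * k * (k - bet * n) ^ 2 := by
  have h : Real.sqrt 3 ^ 2 = 3 := Real.sq_sqrt (by norm_num)
  unfold alp bet
  linear_combination (k * n ^ 2 * (Real.sqrt 3 - 6) / 12 + k ^ 2 * n / 3) * h

lemma f_upper (n : ℕ) : (f n : ℝ) ≤ alp * (n : ℝ) ^ 3 := by
  induction n using Nat.strong_induction_on with
  | _ n ih =>
    have ha : 0 ≤ alp := by unfold alp; linarith [sq3_lo]
    rcases n with _ | _ | m
    · simp [f.eq_1]
    · simp [f.eq_2, ha]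
    · obtain ⟨k, h1, h2, he⟩ := f_attained m
      rw [he]
      have := ih (m + 2 - k) (by omega)
      set N := m + 2 with hN
      push_cast
      rw [choose_two_real]
      have hc : ((N - k : ℕ) : ℝ) = (N : ℝ) - k := by
        rw [Nat.cast_sub h2.le]
      rw [hc] at this ⊢
      have hk : (1 : ℝ) ≤ k := by exact_mod_cast h1
      have hkn : (k : ℝ) < N := by exact_mod_cast h2
      have g := g_identity (k : ℝ) N
      have p : 0 ≤ Real.sqrt 3 / 3 * k * (k - bet * N) ^ 2 := by positivity
      have q : 0 ≤ (k : ℝ) * (N - k) := mul_nonneg (by linarith) (by linarith)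
      nlinarith

lemma f_lower (n : ℕ) : alp * (n : ℝ) ^ 3 - (n : ℝ) ^ 2 ≤ f n := by
  induction n using Nat.strong_induction_on with
  | _ n ih =>
    have lo := sq3_lo
    have hi := sq3_hi
    have ha : 0 ≤ alp := by unfold alp; linarith
    have ha1 : alp ≤ 0.0775 := by unfold alp; linarith
    rcases Nat.lt_or_ge n 13 with h | h
    · have hn : (n : ℝ) ≤ 12 := by exact_mod_cast Nat.le_of_lt_succ h
      have hf : (0 : ℝ) ≤ f n := by positivity
      have : alp * n ≤ 1 := by nlinarith
      have h0 : (0 : ℝ) ≤ n := by positivity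
      nlinarith [mul_nonneg (sq_nonneg (n : ℝ)) (sub_nonneg.2 this)]
    · have hn : (13 : ℝ) ≤ n := by exact_mod_cast h
      have hb1 : 0.6339 < bet := by unfold bet; linarith
      have hb2 : bet < 0.6341 := by unfold bet; linarith
      set k := ⌊bet * n⌋₊ with hk
      have k1 : (k : ℝ) ≤ bet * n := Nat.floor_le (by positivity)
      have k2 : bet * n < k + 1 := Nat.lt_floor_add_one _
      have k3 : (1 : ℝ) < k := by nlinarith
      have k4 : (k : ℝ) < n := by nlinarith
      have k3' : 1 ≤ k := by exact_mod_cast k3.le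
      have k4' : k < n := by exact_mod_cast k4
      have r := f_rec k3' k4'
      have r' : ((Nat.choose k 2 : ℕ) : ℝ) * ((n - k : ℕ) : ℝ) + (f (n - k) : ℝ) ≤ f n := by
        exact_mod_cast r
      have i := ih (n - k) (by omega)
      rw [choose_two_real] at r'
      have hc : ((n - k : ℕ) : ℝ) = (n : ℝ) - k := by
        rw [Nat.cast_sub k4'.le]
      rw [hc] at r' i
      have g := g_identity (k : ℝ) n
      have e1 : ((k : ℝ) - bet * n) ^ 2 ≤ 1 := by nlinarith
      have e2 : Real.sqrt 3 / 3 * k * (k - bet * n) ^ 2 ≤ 0.58 * n := by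
        have : Real.sqrt 3 / 3 * k ≤ 0.58 * n := by nlinarith
        have h0 : 0 ≤ Real.sqrt 3 / 3 * k := by positivity
        nlinarith
      have e3 : (k : ℝ) * (n - k) ≤ n ^ 2 / 4 := by nlinarith [sq_nonneg ((n : ℝ) - 2 * k)]
      have e4 : ((n : ℝ) - k) ≤ 0.45 * n := by nlinarith
      have e5 : ((n : ℝ) - k) ^ 2 ≤ 0.21 * n ^ 2 := by nlinarith
      nlinarith

end FBounds

/-- The three possible states of a pair, seen from one of its end points. -/
inductive Col
  | blue
  | out
  | inn

section Moves

open Finset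

set_option linter.unusedSectionVars false

variable {V : Type} [Fintype V] [DecidableEq V]

/-- Replace all pairs at `v` according to the profile `p`. -/
def upd (G : ColouredGraph V) (v : V) (p : V → Col) : ColouredGraph V where
  Blue x y := if x = v then p y = Col.blue else if y = v then p x = Col.blue else G.Blue x y
  Red x y := if x = v then p y = Col.out else if y = v then p x = Col.inn else G.Red x y
  blue_symm x y h := by
    by_cases hx : x = v <;> by_cases hy : y = v <;> simp_all
    exact G.blue_symm _ _ h
  trichotomy x y h := by
    by_cases hx : x = v
    · have hy : y ≠ v := fun h' => h (hx.trans h'.symm)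
      cases hp : p y <;> simp [hx, hy]
    · by_cases hy : y = v
      · cases hp : p x <;> simp [hx, hy]
      · simpa [hx, hy] using G.trichotomy x y h

open Classical in
/-- The profile of `v` in `G`. -/
noncomputable def prof (G : ColouredGraph V) (v w : V) : Col :=
  if G.Blue v w then Col.blue else if G.Red v w then Col.out else Col.inn

lemma rr_congr {G H : ColouredGraph V} {x y : V} (h : G.Red x y ↔ H.Red x y) :
    rr G x y = rr H x y := by
  unfold rr
  by_cases h1 : x ≠ y ∧ G.Red x y
  · rw [if_pos h1, if_pos ⟨h1.1, h.1 h1.2⟩]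
  · rw [if_neg h1, if_neg (fun h2 => h1 ⟨h2.1, h.2 h2.2⟩)]

lemma bb_congr {G H : ColouredGraph V} {x y : V} (h : G.Blue x y ↔ H.Blue x y) :
    bb G x y = bb H x y := by
  unfold bb
  by_cases h1 : x ≠ y ∧ G.Blue x y
  · rw [if_pos h1, if_pos ⟨h1.1, h.1 h1.2⟩]
  · rw [if_neg h1, if_neg (fun h2 => h1 ⟨h2.1, h.2 h2.2⟩)]

lemma upd_rr_ne (G : ColouredGraph V) (p : V → Col) {v x y : V} (hx : x ≠ v) (hy : y ≠ v) :
    rr (upd G v p) x y = rr G x y := by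
  exact rr_congr (by simp [upd, hx, hy])

lemma upd_bb_ne (G : ColouredGraph V) (p : V → Col) {v x y : V} (hx : x ≠ v) (hy : y ≠ v) :
    bb (upd G v p) x y = bb G x y := by
  exact bb_congr (by simp [upd, hx, hy])

lemma upd_blue (G : ColouredGraph V) {p : V → Col} {v y : V} (hy : y ≠ v) (h : p y = Col.blue) :
    bb (upd G v p) v y = 1 ∧ bb (upd G v p) y v = 1 ∧ rr (upd G v p) v y = 0 ∧
      rr (upd G v p) y v = 0 := by
  simp [rr, bb, upd, hy, h, hy.symm]

lemma upd_out (G : ColouredGraph V) {p : V → Col} {v y : V} (hy : y ≠ v) (h : p y = Col.out) :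
    bb (upd G v p) v y = 0 ∧ bb (upd G v p) y v = 0 ∧ rr (upd G v p) v y = 1 ∧
      rr (upd G v p) y v = 0 := by
  simp [rr, bb, upd, hy, h, hy.symm]

lemma upd_inn (G : ColouredGraph V) {p : V → Col} {v y : V} (hy : y ≠ v) (h : p y = Col.inn) :
    bb (upd G v p) v y = 0 ∧ bb (upd G v p) y v = 0 ∧ rr (upd G v p) v y = 0 ∧
      rr (upd G v p) y v = 1 := by
  simp [rr, bb, upd, hy, h, hy.symm]

/-- An updated pair gets the values of the profile it was copied from. -/
lemma upd_prof (G : ColouredGraph V) {p : V → Col} {u v y : V} (hu : y ≠ u) (hv : y ≠ v)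
    (h : p y = prof G v y) :
    bb (upd G u p) u y = bb G v y ∧ bb (upd G u p) y u = bb G y v ∧
    rr (upd G u p) u y = rr G v y ∧ rr (upd G u p) y u = rr G y v := by
  have t := G.trichotomy v y hv.symm
  have hs1 := G.blue_symm v y
  have hs2 := G.blue_symm y v
  have hb : G.Blue v y ↔ G.Blue y v := ⟨hs1, hs2⟩
  by_cases h1 : G.Blue v y
  · have hp : p y = Col.blue := by rw [h]; simp [prof, h1]
    obtain ⟨a, b, c, d⟩ := upd_blue G hu hp
    have : ¬ G.Red v y ∧ ¬ G.Red y v := by tauto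
    rw [a, b, c, d]
    simp [rr, bb, hb.1 h1, h1, hv, hv.symm, this]
  · by_cases h2 : G.Red v y
    · have hp : p y = Col.out := by rw [h]; simp [prof, h1, h2]
      obtain ⟨a, b, c, d⟩ := upd_out G hu hp
      have h3 : ¬ G.Red y v := by tauto
      have h4 : ¬ G.Blue y v := by tauto
      rw [a, b, c, d]
      simp [rr, bb, h1, h2, h3, h4, hv.symm]
    · have hp : p y = Col.inn := by rw [h]; simp [prof, h1, h2]
      obtain ⟨a, b, c, d⟩ := upd_inn G hu hp
      have h3 : G.Red y v := by tauto
      have h4 : ¬ G.Blue y v := by tauto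
      rw [a, b, c, d]
      simp [rr, bb, h1, h2, h3, h4, hv]

/-- Twice the number of cherries containing `v`. -/
noncomputable def dv (G : ColouredGraph V) (v : V) : ℝ :=
  ∑ y, ∑ z, rr G v y * rr G v z * bb G y z + 2 * ∑ x, ∑ z, rr G x v * rr G x z * bb G v z

lemma c2_dv (G : ColouredGraph V) (v : V) :
    c2 G = S3 G {v}ᶜ {v}ᶜ {v}ᶜ + dv G v := by
  have h1 : ∑ y, ∑ z, rr G v y * rr G v z * bb G y z = S3 G {v} {v}ᶜ {v}ᶜ := by
    unfold S3
    rw [sum_split {v}]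
    simp only [sum_split {v}]
    simp
  have h2 : ∑ x, ∑ z, rr G x v * rr G x z * bb G v z = S3 G {v}ᶜ {v} {v}ᶜ := by
    unfold S3
    rw [sum_split {v}]
    simp only [sum_split {v}]
    simp
  rw [c2_split G {v}, dv, h1, h2]
  have h3 : S3 G {v}ᶜ {v} {v} = 0 := by simp [S3]
  have h4 : S3 G {v} {v} {v} = 0 := by simp [S3]
  have h5 : S3 G {v} {v} {v}ᶜ = 0 := by simp [S3]
  rw [h3, h4, h5]; ring

lemma c2_upd (G : ColouredGraph V) (v : V) (p : V → Col) :
    c2 (upd G v p) - c2 G = dv (upd G v p) v - dv G v := by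
  rw [c2_dv G v, c2_dv (upd G v p) v]
  have : S3 (upd G v p) {v}ᶜ {v}ᶜ {v}ᶜ = S3 G {v}ᶜ {v}ᶜ {v}ᶜ := by
    unfold S3
    refine sum_congr rfl fun x hx => sum_congr rfl fun y hy => sum_congr rfl fun z hz => ?_
    simp only [mem_compl, mem_singleton] at hx hy hz
    rw [upd_rr_ne G p hx hy, upd_rr_ne G p hx hz, upd_bb_ne G p hy hz]
  rw [this]; ring

open Classical in
/-- `1` if the two graphs differ on the pair `x, y`. -/
noncomputable def ddi (G H : ColouredGraph V) (x y : V) : ℝ :=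
  if x ≠ y ∧ ¬ ((G.Blue x y ↔ H.Blue x y) ∧ (G.Red x y ↔ H.Red x y) ∧ (G.Red y x ↔ H.Red y x))
    then 1 else 0

/-- The number of ordered pairs on which two graphs differ. -/
noncomputable def dd (G H : ColouredGraph V) : ℝ := ∑ x, ∑ y, ddi G H x y

lemma ddi_nonneg (G H : ColouredGraph V) (x y : V) : 0 ≤ ddi G H x y := by
  unfold ddi; split_ifs <;> norm_num

lemma ddi_le_one (G H : ColouredGraph V) (x y : V) : ddi G H x y ≤ 1 := by
  unfold ddi; split_ifs <;> norm_num

lemma dd_nonneg (G H : ColouredGraph V) : 0 ≤ dd G H :=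
  sum_nonneg fun _ _ => sum_nonneg fun _ _ => ddi_nonneg _ _ _ _

lemma dd_self (G : ColouredGraph V) : dd G G = 0 := by simp [dd, ddi]

lemma dd_symm (G H : ColouredGraph V) : dd G H = dd H G := by
  unfold dd
  refine sum_congr rfl fun x _ => sum_congr rfl fun y _ => ?_
  unfold ddi
  congr 1
  apply propext
  tauto

lemma dd_triangle (G H K : ColouredGraph V) : dd G K ≤ dd G H + dd H K := by
  unfold dd
  rw [← sum_add_distrib]
  refine sum_le_sum fun x _ => ?_
  rw [← sum_add_distrib]
  refine sum_le_sum fun y _ => ?_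
  by_cases h : x ≠ y ∧ ¬ ((G.Blue x y ↔ K.Blue x y) ∧ (G.Red x y ↔ K.Red x y) ∧
      (G.Red y x ↔ K.Red y x))
  · by_cases h1 : x ≠ y ∧ ¬ ((G.Blue x y ↔ H.Blue x y) ∧ (G.Red x y ↔ H.Red x y) ∧
      (G.Red y x ↔ H.Red y x))
    · have : ddi G H x y = 1 := by unfold ddi; rw [if_pos h1]
      linarith [ddi_le_one G K x y, ddi_nonneg H K x y]
    · have h2 : x ≠ y ∧ ¬ ((H.Blue x y ↔ K.Blue x y) ∧ (H.Red x y ↔ K.Red x y) ∧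
        (H.Red y x ↔ K.Red y x)) := by
        refine ⟨h.1, fun h3 => h.2 ?_⟩
        have h4 : ((G.Blue x y ↔ H.Blue x y) ∧ (G.Red x y ↔ H.Red x y) ∧
          (G.Red y x ↔ H.Red y x)) := by
          by_contra h5; exact h1 ⟨h.1, h5⟩
        exact ⟨h4.1.trans h3.1, h4.2.1.trans h3.2.1, h4.2.2.trans h3.2.2⟩
      have : ddi H K x y = 1 := by unfold ddi; rw [if_pos h2]
      linarith [ddi_le_one G K x y, ddi_nonneg G H x y]
  · have : ddi G K x y = 0 := by unfold ddi; rw [if_neg h]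
    linarith [ddi_nonneg G H x y, ddi_nonneg H K x y]

lemma ddi_rr (G H : ColouredGraph V) (x y : V) (h : ddi G H x y = 0) :
    rr G x y = rr H x y ∧ bb G x y = bb H x y := by
  unfold ddi at h
  by_cases hxy : x = y
  · subst hxy; simp
  · have : ((G.Blue x y ↔ H.Blue x y) ∧ (G.Red x y ↔ H.Red x y) ∧
      (G.Red y x ↔ H.Red y x)) := by
      by_contra h5
      rw [if_pos ⟨hxy, h5⟩] at h
      norm_num at h
    exact ⟨rr_congr this.2.1, bb_congr this.1⟩

lemma ddi_upd_ne (G : ColouredGraph V) (p : V → Col) {v x y : V} (hx : x ≠ v) (hy : y ≠ v) :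
    ddi G (upd G v p) x y = 0 := by
  simp [ddi, upd, hx, hy]

lemma dd_upd (G : ColouredGraph V) (v : V) (p : V → Col) :
    dd G (upd G v p) ≤ 2 * (Fintype.card V : ℝ) := by
  have : dd G (upd G v p) ≤ ∑ x : V, ∑ y : V, ((if x = v then 1 else 0) + (if y = v then 1 else 0) : ℝ) := by
    refine sum_le_sum fun x _ => sum_le_sum fun y _ => ?_
    by_cases hx : x = v <;> by_cases hy : y = v
    · rw [if_pos hx, if_pos hy]; linarith [ddi_le_one G (upd G v p) x y]
    · rw [if_pos hx, if_neg hy]; linarith [ddi_le_one G (upd G v p) x y]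
    · rw [if_neg hx, if_pos hy]; linarith [ddi_le_one G (upd G v p) x y]
    · rw [if_neg hx, if_neg hy, ddi_upd_ne G p hx hy]; norm_num
  refine this.trans (le_of_eq ?_)
  simp [sum_add_distrib]
  ring

/-- Updating a single pair. -/
lemma dd_upd_pair (G : ColouredGraph V) (u v : V) (p : V → Col) (huv : u ≠ v)
    (h : ∀ w, w ≠ u → w ≠ v → p w = prof G u w) :
    dd G (upd G u p) ≤ 2 := by
  have : dd G (upd G u p) ≤ ∑ x : V, ∑ y : V,
      ((if x = u then if y = v then 1 else 0 else 0) +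
        (if x = v then if y = u then 1 else 0 else 0) : ℝ) := by
    refine sum_le_sum fun x _ => sum_le_sum fun y _ => ?_
    have key : ∀ w, w ≠ u → w ≠ v → ((G.Blue u w ↔ (upd G u p).Blue u w) ∧
        (G.Red u w ↔ (upd G u p).Red u w) ∧ (G.Red w u ↔ (upd G u p).Red w u)) ∧
        (G.Blue w u ↔ (upd G u p).Blue w u) := by
      intro w h1 h2
      have t := G.trichotomy u w (Ne.symm h1)
      have hb : G.Blue u w ↔ G.Blue w u := ⟨G.blue_symm _ _, G.blue_symm _ _⟩
      by_cases b1 : G.Blue u w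
      · have hp : p w = Col.blue := by rw [h w h1 h2]; simp [prof, b1]
        simp only [upd, hp, h1, if_true, if_false]
        simp only [reduceCtorEq, iff_true, iff_false]
        tauto
      · by_cases b2 : G.Red u w
        · have hp : p w = Col.out := by rw [h w h1 h2]; simp [prof, b1, b2]
          simp only [upd, hp, h1, if_true, if_false]
          simp only [reduceCtorEq, iff_true, iff_false]
          tauto
        · have hp : p w = Col.inn := by rw [h w h1 h2]; simp [prof, b1, b2]
          simp only [upd, hp, h1, if_true, if_false]
          simp only [reduceCtorEq, iff_true, iff_false]
          tauto
    by_cases hx : x = u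
    · subst hx
      by_cases hy : y = v
      · subst hy
        simp [huv]
        exact ddi_le_one _ _ _ _
      · by_cases hyx : y = x
        · subst hyx; simp [ddi, huv]
        · have := (key y hyx hy).1
          have h0 : ddi G (upd G x p) x y = 0 := by
            unfold ddi; rw [if_neg]; exact fun h' => h'.2 this
          rw [h0]; simp [hy, huv]
    · by_cases hy : y = u
      · subst hy
        by_cases hxv : x = v
        · subst hxv
          simp [hx]
          exact ddi_le_one _ _ _ _
        · have := key x hx hxv
          have h0 : ddi G (upd G y p) x y = 0 := by
            unfold ddi; rw [if_neg]; exact fun h' => h'.2 ⟨this.2, this.1.2.2, this.1.2.1⟩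
          rw [h0]; simp [hx, hxv]
      · rw [ddi_upd_ne G p hx hy]; simp [hx, hy]
  refine this.trans (le_of_eq ?_)
  simp [sum_add_distrib]
  norm_num

/-- Cloning `v` onto the blue neighbour `u`. -/
lemma dv_clone (G : ColouredGraph V) (u v : V) (huv : bb G u v = 1) (p : V → Col)
    (hp : ∀ w, w ≠ v → p w = prof G v w) (hpv : p v = Col.blue) :
    dv (upd G u p) u = dv G v + 2 * (∑ x, rr G x v - ∑ x, rr G x u * rr G x v) := by
  have hne : u ≠ v := by rintro rfl; simp at huv
  have t := tri G hne
  have n1 := rr_nonneg G u v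
  have n2 := rr_nonneg G v u
  have r1 : rr G u v = 0 := by linarith
  have r2 : rr G v u = 0 := by linarith
  obtain ⟨v1, v2, v3, v4⟩ := upd_blue G hne.symm hpv
  have a1 : ∀ y, rr (upd G u p) u y = rr G v y := by
    intro y
    by_cases hy : y = u
    · subst hy; simp [r2]
    · by_cases hyv : y = v
      · subst hyv; simp [v3]
      · exact (upd_prof G hy hyv (hp y hyv)).2.2.1
  have a2 : ∀ y, rr (upd G u p) y u = rr G y v := by
    intro y
    by_cases hy : y = u
    · subst hy; simp [r1]
    · by_cases hyv : y = v
      · subst hyv; simp [v4]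
      · exact (upd_prof G hy hyv (hp y hyv)).2.2.2
  have b1 : ∀ y, y ≠ u → y ≠ v → bb (upd G u p) u y = bb G v y := fun y hy hyv =>
    (upd_prof G hy hyv (hp y hyv)).1
  have s1 : ∑ y, ∑ z, rr (upd G u p) u y * rr (upd G u p) u z * bb (upd G u p) y z
      = ∑ y, ∑ z, rr G v y * rr G v z * bb G y z := by
    refine sum_congr rfl fun y _ => sum_congr rfl fun z _ => ?_
    rw [a1, a1]
    by_cases hy : y = u
    · subst hy; simp [r2]
    · by_cases hz : z = u
      · subst hz; simp [r2]
      · rw [upd_bb_ne G p hy hz]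
  have s2 : ∑ x, ∑ z, rr (upd G u p) x u * rr (upd G u p) x z * bb (upd G u p) u z
      = ∑ x, ∑ z, (rr G x v * rr G x z * bb G v z + (if z = v then rr G x v else 0)
        - (if z = u then rr G x u * rr G x v else 0)) := by
    refine sum_congr rfl fun x _ => sum_congr rfl fun z _ => ?_
    rw [a2]
    by_cases hx : x = u
    · subst hx; simp [r1]
    · by_cases hz : z = u
      · subst hz
        have : bb G v z = 1 := by rw [bb_comm]; exact huv
        simp [hne, this]; ring
      · by_cases hzv : z = v
        · subst hzv
          rw [v1, upd_rr_ne G p hx hz]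
          rcases rr_zero_or_one G x z with h | h <;> simp [h, hz]
        · rw [upd_rr_ne G p hx hz, b1 z hz hzv]; simp [hz, hzv]
  unfold dv
  rw [s1, s2]
  simp only [sum_add_distrib, sum_sub_distrib, sum_ite_eq', mem_univ, if_true]
  ring

/-- The number of pairs that are bad with respect to `Q`. -/
noncomputable def DD (G : ColouredGraph V) (Q : Finset V) : ℝ :=
  ∑ x ∈ Q, ∑ y, rr G x y + ∑ x ∈ Q, ∑ y ∈ Qᶜ, bb G x y

lemma DD_le (G H : ColouredGraph V) (Q : Finset V) : DD G Q ≤ DD H Q + dd G H := by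
  have e : ∀ K : ColouredGraph V, DD K Q = ∑ x ∈ Q, ∑ y, (rr K x y + if y ∈ Qᶜ then bb K x y else 0) := by
    intro K
    simp only [DD, sum_add_distrib]
    congr 1
    refine sum_congr rfl fun x _ => ?_
    rw [← sum_filter]
    congr 1
    ext y
    simp
  have h1 : ∑ x ∈ Q, ∑ y, ddi G H x y ≤ dd G H := by
    unfold dd
    exact sum_le_univ_sum_of_nonneg (fun x => sum_nonneg fun y _ => ddi_nonneg _ _ _ _)
  refine le_trans ?_ (add_le_add_right h1 _)
  rw [e, e, ← sum_add_distrib]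
  refine sum_le_sum fun x _ => ?_
  rw [← sum_add_distrib]
  refine sum_le_sum fun y _ => ?_
  rcases (show ddi G H x y = 0 ∨ ddi G H x y = 1 by unfold ddi; split_ifs <;> simp) with h | h
  · obtain ⟨h1, h2⟩ := ddi_rr G H x y h
    rw [h1, h2, h]; simp
  · rw [h]
    have i1 := rr_nonneg H x y
    have i2 := bb_nonneg H x y
    have i3 : rr G x y + bb G x y ≤ 1 := by
      by_cases hxy : x = y
      · subst hxy; simp
      · linarith [tri G hxy, rr_nonneg G y x]
    have i4 := bb_nonneg G x y
    split_ifs <;> linarith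

end Moves

section Zykov

open Finset

set_option linter.unusedSectionVars false

/-- The restriction of a coloured graph to a set of vertices. -/
def restr {V : Type} (G : ColouredGraph V) (R : Finset V) : ColouredGraph {v // v ∈ R} where
  Blue x y := G.Blue x y
  Red x y := G.Red x y
  blue_symm _ _ h := G.blue_symm _ _ h
  trichotomy _ _ h := G.trichotomy _ _ (fun h' => h (Subtype.ext h'))

variable {V : Type} [Fintype V] [DecidableEq V]

lemma restr_rr (G : ColouredGraph V) (R : Finset V) (x y : {v // v ∈ R}) :
    rr (restr G R) x y = rr G x y := by
  unfold rr
  have : (x ≠ y ∧ (restr G R).Red x y) ↔ ((x : V) ≠ y ∧ G.Red x y) := by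
    exact ⟨fun h => ⟨fun h' => h.1 (Subtype.ext h'), h.2⟩, fun h => ⟨fun h' => h.1 (congrArg Subtype.val h'), h.2⟩⟩
  by_cases h : (x : V) ≠ y ∧ G.Red x y
  · rw [if_pos h, if_pos (this.2 h)]
  · rw [if_neg h, if_neg (fun h' => h (this.1 h'))]

lemma restr_bb (G : ColouredGraph V) (R : Finset V) (x y : {v // v ∈ R}) :
    bb (restr G R) x y = bb G x y := by
  unfold bb
  have : (x ≠ y ∧ (restr G R).Blue x y) ↔ ((x : V) ≠ y ∧ G.Blue x y) := by
    exact ⟨fun h => ⟨fun h' => h.1 (Subtype.ext h'), h.2⟩, fun h => ⟨fun h' => h.1 (congrArg Subtype.val h'), h.2⟩⟩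
  by_cases h : (x : V) ≠ y ∧ G.Blue x y
  · rw [if_pos h, if_pos (this.2 h)]
  · rw [if_neg h, if_neg (fun h' => h (this.1 h'))]

lemma c2_restr (G : ColouredGraph V) (R : Finset V) : c2 (restr G R) = S3 G R R R := by
  unfold c2 S3
  rw [← Finset.sum_coe_sort R]
  refine sum_congr rfl fun x _ => ?_
  rw [← Finset.sum_coe_sort R]
  refine sum_congr rfl fun y _ => ?_
  rw [← Finset.sum_coe_sort R]
  refine sum_congr rfl fun z _ => ?_
  rw [restr_rr, restr_rr, restr_bb]

lemma finite_cg : Finite (ColouredGraph V) := by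
  have : Function.Injective (fun G : ColouredGraph V => (G.Blue, G.Red)) := by
    rintro ⟨b, r, _, _⟩ ⟨b', r', _, _⟩ h
    simp only [Prod.mk.injEq] at h
    obtain ⟨rfl, rfl⟩ := h
    rfl
  exact Finite.of_injective _ this

/-- One symmetrization step: few pairs change and the number of cherries does not drop. -/
def Stp (G H : ColouredGraph V) : Prop := c2 G ≤ c2 H ∧ dd G H ≤ 2 * (Fintype.card V : ℝ)

/-- Graphs in which blue neighbours have the same in-neighbourhood. -/
def IsFin (H : ColouredGraph V) : Prop := ∀ u v, bb H u v = 1 → ∀ x, rr H x u = rr H x v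

lemma exists_fin (G : ColouredGraph V) : ∃ H, Relation.ReflTransGen Stp G H ∧ IsFin H := by
  have := finite_cg (V := V)
  obtain ⟨H, hH, hmax⟩ := Set.exists_max_image {H | Relation.ReflTransGen Stp G H} c2
    (Set.toFinite _) ⟨G, Relation.ReflTransGen.refl⟩
  refine ⟨H, hH, ?_⟩
  have key : ∀ u v, bb H u v = 1 → dv H u ≤ dv H v →
      dv H v = dv H u ∧ ∀ x, rr H x v ≤ rr H x u := by
    intro u v huv hd
    classical
    set p : V → Col := fun w => if w = v then Col.blue else prof H v w with hp
    have c := dv_clone H u v huv p (fun w hw => by simp [hp, hw]) (by simp [hp])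
    have e := c2_upd H u p
    have e2 : ∑ x, rr H x v - ∑ x, rr H x u * rr H x v = ∑ x, (1 - rr H x u) * rr H x v := by
      rw [← sum_sub_distrib]; exact sum_congr rfl fun x _ => by ring
    have nn : ∀ x ∈ univ, 0 ≤ (1 - rr H x u) * rr H x v := fun x _ =>
      mul_nonneg (sub_nonneg.2 (rr_le_one _ _ _)) (rr_nonneg _ _ _)
    have e3 := sum_nonneg nn
    rw [e2] at c
    have m := hmax (upd H u p) (Relation.ReflTransGen.tail hH ⟨by linarith, dd_upd H u p⟩)
    refine ⟨by linarith, ?_⟩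
    have z : ∑ x, (1 - rr H x u) * rr H x v = 0 := by linarith
    rw [sum_eq_zero_iff_of_nonneg nn] at z
    intro x
    have zx := z x (mem_univ x)
    rcases rr_zero_or_one H x u with h | h
    · rw [h] at zx ⊢; linarith
    · rw [h]; exact rr_le_one _ _ _
  have key2 : ∀ u v, bb H u v = 1 → dv H u ≤ dv H v → ∀ x, rr H x u = rr H x v := by
    intro u v huv hd x
    obtain ⟨h1, h2⟩ := key u v huv hd
    obtain ⟨_, h3⟩ := key v u (by rw [bb_comm]; exact huv) h1.le
    exact le_antisymm (h3 x) (h2 x)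
  intro u v huv x
  rcases le_total (dv H u) (dv H v) with h | h
  · exact key2 u v huv h x
  · exact (key2 v u (by rw [bb_comm]; exact huv) h x).symm

lemma card_real_compl (Q : Finset V) : ((Qᶜ).card : ℝ) = (Fintype.card V : ℝ) - Q.card := by
  rw [card_compl, Nat.cast_sub (card_le_univ Q)]

lemma fin_struct (H : ColouredGraph V) (hF : IsFin H) [Nonempty V] :
    ∃ (Q : Finset V) (w : ℝ), 1 ≤ Q.card ∧ 0 ≤ w ∧ w ≤ (Qᶜ).card ∧
      DD H Q = Q.card * w ∧
      (∀ m : ℝ, ((Q.card : ℝ) - 1 ≤ m ∨ ((Qᶜ).card : ℝ) - 1 ≤ m) →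
        c2 H ≤ ((Q.card : ℝ) ^ 2 - Q.card) * ((Qᶜ).card - w) + Q.card * w * m
          + S3 H Qᶜ Qᶜ Qᶜ) ∧
      c2 H ≤ (Fintype.card V : ℝ) ^ 2 * Q.card := by
  classical
  obtain ⟨v, -, hv⟩ := exists_max_image (univ : Finset V) (fun v => ∑ z, bb H v z)
    univ_nonempty
  set Q : Finset V := univ.filter fun w => w = v ∨ bb H v w = 1 with hQ
  have memQ : ∀ w, w ∈ Q ↔ (w = v ∨ bb H v w = 1) := fun w => by simp [hQ]
  have blue0 : ∀ x y, bb H x y = 1 → rr H x y = 0 ∧ rr H y x = 0 := by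
    intro x y h
    have hne : x ≠ y := by rintro rfl; simp at h
    have := tri H hne
    have := rr_nonneg H x y
    have := rr_nonneg H y x
    constructor <;> linarith
  have trans : ∀ u v w, bb H u v = 1 → bb H v w = 1 → u ≠ w → bb H u w = 1 := by
    intro u v w h1 h2 h3
    have t := tri H h3
    have a1 : rr H u w = 0 := by rw [← hF v w h2 u]; exact (blue0 _ _ h1).1
    have a2 : rr H w u = 0 := by rw [hF u v h1 w]; exact (blue0 _ _ h2).2
    linarith
  have vQ : v ∈ Q := by simp [memQ]
  have QQ : ∀ x ∈ Q, ∀ y ∈ Q, x ≠ y → bb H x y = 1 := by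
    intro x hx y hy hxy
    rcases (memQ x).1 hx with rfl | hx'
    · rcases (memQ y).1 hy with rfl | hy'
      · exact absurd rfl hxy
      · exact hy'
    · rcases (memQ y).1 hy with rfl | hy'
      · rw [bb_comm]; exact hx'
      · exact trans x v y (by rw [bb_comm]; exact hx') hy' hxy
  have QR : ∀ x ∈ Q, ∀ y ∈ Qᶜ, bb H x y = 0 := by
    intro x hx y hy
    rcases bb_zero_or_one H x y with h | h
    · exact h
    · exfalso
      rw [mem_compl] at hy
      apply hy
      rw [memQ]
      by_cases hyv : y = v
      · exact Or.inl hyv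
      · right
        rcases (memQ x).1 hx with rfl | hx'
        · exact h
        · exact trans v x y hx' h (Ne.symm hyv)
  have QQr : ∀ x ∈ Q, ∀ y ∈ Q, rr H x y = 0 := by
    intro x hx y hy
    by_cases h : x = y
    · subst h; simp
    · exact (blue0 _ _ (QQ x hx y hy h)).1
  have ain : ∀ x ∈ Q, ∀ y, rr H y x = rr H y v := by
    intro x hx y
    rcases (memQ x).1 hx with rfl | hx'
    · rfl
    · exact (hF v x hx' y).symm
  have aout : ∀ x ∈ Q, ∀ y ∈ Qᶜ, rr H x y = 1 - rr H y v := by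
    intro x hx y hy
    have hne : x ≠ y := by rintro rfl; exact (mem_compl.1 hy) hx
    have t := tri H hne
    rw [QR x hx y hy, ain x hx y] at t
    linarith
  have sumQ : ∑ z, bb H v z = (Q.card : ℝ) - 1 := by
    have : ∑ z, bb H v z = ∑ z ∈ Q.erase v, (1 : ℝ) := by
      rw [sum_split Q, sum_eq_zero (s := Qᶜ) (fun z hz => QR v vQ z hz), add_zero,
        ← add_sum_erase Q _ vQ, bb_self, zero_add]
      refine sum_congr rfl fun z hz => ?_
      rw [mem_erase] at hz
      exact QQ v vQ z hz.2 (Ne.symm hz.1)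
    rw [this, sum_const, nsmul_eq_mul, mul_one, card_erase_of_mem vQ, Nat.cast_sub (card_pos.2 ⟨v, vQ⟩)]
    simp
  have bdeg : ∀ y, ∑ z, bb H y z ≤ (Q.card : ℝ) - 1 := fun y => by
    rw [← sumQ]; exact hv y (mem_univ y)
  have sub_le : ∀ (y : V) (A : Finset V), ∑ z ∈ A, bb H y z ≤ ∑ z, bb H y z := fun y A =>
    sum_le_univ_sum_of_nonneg (fun z => bb_nonneg _ _ _)
  set w : ℝ := ∑ y ∈ Qᶜ, (1 - rr H y v) with hw
  have hq1 : (1 : ℝ) ≤ Q.card := by exact_mod_cast card_pos.2 ⟨v, vQ⟩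
  refine ⟨Q, w, card_pos.2 ⟨v, vQ⟩, ?_, ?_, ?_, ?_, ?_⟩
  · exact sum_nonneg fun y _ => sub_nonneg.2 (rr_le_one _ _ _)
  · have : w ≤ ∑ y ∈ Qᶜ, (1 : ℝ) := sum_le_sum fun y _ => by linarith [rr_nonneg H y v]
    simpa using this
  · unfold DD
    rw [sum_eq_zero (s := Q) (f := fun x => ∑ y ∈ Qᶜ, bb H x y)
      (fun x hx => sum_eq_zero fun y hy => QR x hx y hy), add_zero]
    have : ∀ x ∈ Q, ∑ y, rr H x y = w := by
      intro x hx
      rw [sum_split Q, sum_eq_zero (s := Q) (fun y hy => QQr x hx y hy), zero_add]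
      exact sum_congr rfl fun y hy => aout x hx y hy
    rw [sum_congr rfl this]; simp
  · intro m hm
    rw [c2_split H Q]
    have z1 : S3 H Q Q Q = 0 := by
      unfold S3
      exact sum_eq_zero fun x hx => sum_eq_zero fun y hy => sum_eq_zero fun z hz => by
        rw [QQr x hx y hy]; ring
    have z2 : S3 H Q Q Qᶜ = 0 := by
      unfold S3
      exact sum_eq_zero fun x hx => sum_eq_zero fun y hy => sum_eq_zero fun z hz => by
        rw [QQr x hx y hy]; ring
    have z3 : S3 H Qᶜ Q Qᶜ = 0 := by
      unfold S3
      exact sum_eq_zero fun x hx => sum_eq_zero fun y hy => sum_eq_zero fun z hz => by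
        rw [QR y hy z hz]; ring
    have z4 : S3 H Qᶜ Q Q ≤ ((Q.card : ℝ) ^ 2 - Q.card) * ((Qᶜ).card - w) := by
      have : S3 H Qᶜ Q Q ≤ ∑ x ∈ Qᶜ, rr H x v * ((Q.card : ℝ) ^ 2 - Q.card) := by
        unfold S3
        refine sum_le_sum fun x hx => ?_
        have b1 : ∑ y ∈ Q, ∑ z ∈ Q, rr H x y * rr H x z * bb H y z
            ≤ ∑ y ∈ Q, rr H x v * ∑ z ∈ Q, bb H y z := by
          refine sum_le_sum fun y hy => ?_
          rw [mul_sum]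
          refine sum_le_sum fun z hz => ?_
          rw [ain y hy x, ain z hz x]
          rcases rr_zero_or_one H x v with h | h <;> rw [h] <;> linarith
        refine b1.trans ?_
        rw [← mul_sum]
        refine mul_le_mul_of_nonneg_left ?_ (rr_nonneg _ _ _)
        have : ∑ y ∈ Q, ∑ z ∈ Q, bb H y z ≤ ∑ y ∈ Q, ((Q.card : ℝ) - 1) :=
          sum_le_sum fun y hy => (sub_le y Q).trans (bdeg y)
        rw [sum_const, nsmul_eq_mul] at this
        linarith
      rw [← sum_mul] at this
      have e : ((Qᶜ).card : ℝ) - w = ∑ x ∈ Qᶜ, rr H x v := by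
        rw [hw, sum_sub_distrib]; simp
      rw [e]; linarith
    have z5 : S3 H Q Qᶜ Qᶜ ≤ Q.card * w * m := by
      have : S3 H Q Qᶜ Qᶜ ≤ ∑ x ∈ Q, w * m := by
        unfold S3
        refine sum_le_sum fun x hx => ?_
        rw [hw, sum_mul]
        refine sum_le_sum fun y hy => ?_
        have b1 : ∑ z ∈ Qᶜ, rr H x y * rr H x z * bb H y z
            ≤ ∑ z ∈ Qᶜ, (1 - rr H y v) * bb H y z := by
          refine sum_le_sum fun z hz => ?_
          rw [← aout x hx y hy]
          have p1 := rr_nonneg H x y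
          have p2 := bb_nonneg H y z
          have p3 := rr_le_one H x z
          nlinarith [mul_nonneg (mul_nonneg p1 p2) (sub_nonneg.2 p3)]
        refine b1.trans ?_
        rw [← mul_sum]
        refine mul_le_mul_of_nonneg_left ?_ (sub_nonneg.2 (rr_le_one _ _ _))
        rcases hm with hm | hm
        · exact ((sub_le y Qᶜ).trans (bdeg y)).trans hm
        · refine le_trans ?_ hm
          rw [← add_sum_erase Qᶜ _ hy, bb_self, zero_add]
          have : ∑ z ∈ Qᶜ.erase y, bb H y z ≤ ∑ z ∈ Qᶜ.erase y, (1 : ℝ) :=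
            sum_le_sum fun z _ => bb_le_one _ _ _
          rw [sum_const, nsmul_eq_mul, mul_one, card_erase_of_mem hy,
            Nat.cast_sub (card_pos.2 ⟨y, hy⟩)] at this
          simpa using this
      rw [sum_const, nsmul_eq_mul] at this
      linarith
    linarith
  · have : c2 H ≤ ∑ x : V, ∑ y : V, (Q.card : ℝ) := by
      unfold c2
      refine sum_le_sum fun x _ => sum_le_sum fun y _ => ?_
      have b1 : ∑ z, rr H x y * rr H x z * bb H y z ≤ ∑ z, bb H y z := by
        refine sum_le_sum fun z _ => ?_
        have p2 := bb_nonneg H y z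
        have : rr H x y * rr H x z ≤ 1 := by
          nlinarith [rr_nonneg H x y, rr_nonneg H x z, rr_le_one H x y, rr_le_one H x z]
        nlinarith
      linarith [bdeg y]
    refine this.trans (le_of_eq ?_)
    simp; ring

lemma c2_mono_reach {G H : ColouredGraph V} (h : Relation.ReflTransGen Stp G H) :
    c2 G ≤ c2 H := by
  induction h with
  | refl => exact le_rfl
  | tail _ h2 ih => exact ih.trans h2.1

lemma c2_le_f : ∀ (n : ℕ) (V : Type) [Fintype V] [DecidableEq V] (G : ColouredGraph V),
    Fintype.card V = n → c2 G ≤ 2 * (f n : ℝ) := by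
  intro n
  induction n using Nat.strong_induction_on with
  | _ n ih =>
    intro V _ _ G hn
    rcases Nat.eq_zero_or_pos n with h0 | h0
    · have : IsEmpty V := Fintype.card_eq_zero_iff.1 (hn.trans h0)
      have : c2 G = 0 := by simp [c2]
      rw [this]; positivity
    · have : Nonempty V := Fintype.card_pos_iff.1 (hn ▸ h0)
      obtain ⟨H, hR, hF⟩ := exists_fin G
      refine (c2_mono_reach hR).trans ?_
      obtain ⟨Q, w, q1, w0, w1, -, hc, -⟩ := fin_struct H hF
      have h1 := hc ((Q.card : ℝ) - 1) (Or.inl le_rfl)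
      have hr : (Qᶜ).card = n - Q.card := by rw [card_compl, hn]
      have hS : S3 H Qᶜ Qᶜ Qᶜ ≤ 2 * (f (n - Q.card) : ℝ) := by
        rw [← c2_restr]
        exact ih (n - Q.card) (by omega) _ _ (by rw [Fintype.card_coe, hr])
      have h2 : c2 H ≤ 2 * ((Q.card.choose 2 : ℕ) * ((n - Q.card : ℕ) : ℝ) + f (n - Q.card)) := by
        rw [choose_two_real, ← hr]
        rw [← hr] at hS
        nlinarith
      have hqn : Q.card ≤ n := hn ▸ card_le_univ Q
      rcases Nat.lt_or_ge Q.card n with h3 | h3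
      · have := f_rec q1 h3
        have h4 : ((Q.card.choose 2 : ℕ) * ((n - Q.card : ℕ) : ℝ) + f (n - Q.card)) ≤ (f n : ℝ) := by
          exact_mod_cast this
        linarith
      · have : n - Q.card = 0 := by omega
        rw [this] at h2
        have h5 : (0 : ℝ) ≤ f n := by positivity
        simp [f.eq_1] at h2
        linarith

lemma S3_le_f (G : ColouredGraph V) (R : Finset V) : S3 G R R R ≤ 2 * (f R.card : ℝ) := by
  rw [← c2_restr]
  exact c2_le_f R.card _ _ (by rw [Fintype.card_coe])

set_option maxHeartbeats 1000000 in
lemma fin_close (H : ColouredGraph V) (hF : IsFin H) (s : ℝ) (hs : s ≤ 0.000000001)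
    (hn : 0 < Fintype.card V)
    (hc : 2 * alp * (Fintype.card V : ℝ) ^ 3 - 2 * s * (Fintype.card V : ℝ) ^ 3 ≤ c2 H) :
    ∃ Q : Finset V, (Fintype.card V : ℝ) / 2 ≤ Q.card ∧
      DD H Q ≤ 0.000005 * (Fintype.card V : ℝ) ^ 2 := by
  have : Nonempty V := Fintype.card_pos_iff.1 hn
  obtain ⟨Q, w, q1, w0, w1, hD, hcc, hq⟩ := fin_struct H hF
  refine ⟨Q, ?_⟩
  have h1 := hcc ((Q.card : ℝ) - 1) (Or.inl le_rfl)
  have h2 := hcc (((Qᶜ).card : ℝ) - 1) (Or.inr le_rfl)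
  have hS := (S3_le_f H Qᶜ).trans (mul_le_mul_of_nonneg_left (f_upper _) (by norm_num))
  rw [hD]
  have hnp : (0 : ℝ) < Fintype.card V := by exact_mod_cast hn
  have hq1 : (1 : ℝ) ≤ Q.card := by exact_mod_cast q1
  have hr0 : (0 : ℝ) ≤ (Qᶜ).card := by positivity
  rw [card_real_compl] at *
  set n : ℝ := (Fintype.card V : ℝ)
  set q : ℝ := (Q.card : ℝ)
  have lo := sq3_lo
  have hi := sq3_hi
  have hb1 : 0.6339 < bet := by unfold bet; linarith
  have hb2 : bet < 0.6341 := by unfold bet; linarith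
  have ha1 : 0.0773 < alp := by unfold alp; linarith
  have g := g_identity q n
  have n3 : 0 < n ^ 3 := by positivity
  have n2 : 0 < n ^ 2 := by positivity
  have hsn : s * n ^ 3 ≤ 0.000000001 * n ^ 3 := by nlinarith
  have hq2 : 0.15 * n ≤ q := by
    have : 0.15 * n ^ 3 ≤ n ^ 2 * q := by nlinarith
    have : n ^ 2 * (0.15 * n) ≤ n ^ 2 * q := by linarith
    exact le_of_mul_le_mul_left this n2
  have hqr : 0 ≤ q * (n - q) := mul_nonneg (by linarith) hr0
  have key : Real.sqrt 3 / 3 * q * (q - bet * n) ^ 2 ≤ 0.000000001 * n ^ 3 := by nlinarith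
  have key2 : (q - bet * n) ^ 2 ≤ 0.0000001 * n ^ 2 := by
    have : 0.577 * (0.15 * n) * (q - bet * n) ^ 2 ≤ Real.sqrt 3 / 3 * q * (q - bet * n) ^ 2 := by
      refine mul_le_mul_of_nonneg_right ?_ (sq_nonneg _)
      exact mul_le_mul (by linarith) hq2 (by positivity) (by positivity)
    have h3 : n * (0.08655 * (q - bet * n) ^ 2) ≤ n * (0.000000001 * n ^ 2) := by nlinarith
    have := le_of_mul_le_mul_left h3 hnp
    linarith
  have key3 : |q - bet * n| ≤ 0.001 * n := by
    refine abs_le_of_sq_le_sq ?_ (by positivity)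
    nlinarith
  obtain ⟨k1, k2⟩ := abs_le.1 key3
  have hq3 : 0.6 * n ≤ q := by nlinarith
  refine ⟨by linarith, ?_⟩
  have hqw : 0 ≤ q * w := by positivity
  have p : 0 ≤ Real.sqrt 3 / 3 * q * (q - bet * n) ^ 2 := by positivity
  have k4 : q * w * (2 * q - n) ≤ 0.000000002 * n ^ 3 := by linarith
  have k5 : q * w * (0.2 * n) ≤ q * w * (2 * q - n) :=
    mul_le_mul_of_nonneg_left (by linarith) hqw
  have k6 : n * (q * w * 0.2) ≤ n * (0.000000002 * n ^ 2) := by linarith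
  have := le_of_mul_le_mul_left k6 hnp
  linarith

end Zykov

section Local

open Finset

set_option linter.unusedSectionVars false

variable {V : Type} [Fintype V] [DecidableEq V]

/-- Red out-degree into a set. -/
noncomputable def so (G : ColouredGraph V) (A : Finset V) (v : V) : ℝ := ∑ y ∈ A, rr G v y
/-- Red in-degree from a set. -/
noncomputable def si (G : ColouredGraph V) (A : Finset V) (v : V) : ℝ := ∑ y ∈ A, rr G y v
/-- Blue degree into a set. -/
noncomputable def sb (G : ColouredGraph V) (A : Finset V) (v : V) : ℝ := ∑ y ∈ A, bb G v y

lemma so_nonneg (G : ColouredGraph V) (A : Finset V) (v : V) : 0 ≤ so G A v :=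
  sum_nonneg fun _ _ => rr_nonneg _ _ _
lemma si_nonneg (G : ColouredGraph V) (A : Finset V) (v : V) : 0 ≤ si G A v :=
  sum_nonneg fun _ _ => rr_nonneg _ _ _
lemma sb_nonneg (G : ColouredGraph V) (A : Finset V) (v : V) : 0 ≤ sb G A v :=
  sum_nonneg fun _ _ => bb_nonneg _ _ _

lemma deg_sum_ne (G : ColouredGraph V) (A : Finset V) (v : V) (h : v ∉ A) :
    so G A v + si G A v + sb G A v = A.card := by
  unfold so si sb
  rw [← sum_add_distrib, ← sum_add_distrib]
  rw [show (A.card : ℝ) = ∑ y ∈ A, (1 : ℝ) by simp]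
  refine sum_congr rfl fun y hy => ?_
  have : v ≠ y := by rintro rfl; exact h hy
  linarith [tri G this]

lemma deg_sum_le (G : ColouredGraph V) (A : Finset V) (v : V) :
    so G A v + si G A v + sb G A v ≤ A.card := by
  unfold so si sb
  rw [← sum_add_distrib, ← sum_add_distrib]
  rw [show (A.card : ℝ) = ∑ y ∈ A, (1 : ℝ) by simp]
  refine sum_le_sum fun y hy => ?_
  by_cases h : v = y
  · subst h; simp
  · linarith [tri G h]

lemma DD_insert (G : ColouredGraph V) (Q : Finset V) (v : V) (h : v ∉ Q) :
    DD G (insert v Q) = DD G Q + so G Q v + so G Qᶜ v + sb G Qᶜ v - sb G Q v := by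
  have e1 : ∀ x, ∑ y ∈ Qᶜ, bb G x y = ∑ y ∈ (insert v Q)ᶜ, bb G x y + bb G x v := by
    intro x
    have : Qᶜ = insert v (insert v Q)ᶜ := by
      ext y; simp only [mem_compl, mem_insert]
      by_cases hy : y = v
      · subst hy; simp [h]
      · simp [hy]
    rw [this, sum_insert (by simp)]; ring
  unfold DD so sb
  rw [sum_insert h, sum_insert h]
  simp only [e1, sum_add_distrib]
  rw [sum_split Q (fun y => rr G v y), sum_congr rfl (fun y _ => bb_comm G v y) (s₁ := Q)]
  simp
  ring

lemma DD_erase (G : ColouredGraph V) (Q : Finset V) (v : V) (h : v ∈ Q) :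
    DD G Q = DD G (Q.erase v) + so G Q v + so G Qᶜ v + sb G Qᶜ v - sb G Q v := by
  have h1 := DD_insert G (Q.erase v) v (by simp)
  rw [insert_erase h] at h1
  have e : (Q.erase v)ᶜ = insert v Qᶜ := by
    ext y; simp only [mem_compl, mem_insert, mem_erase]; tauto
  have hv : v ∉ Qᶜ := by simpa using h
  have e1 : so G (Q.erase v) v = so G Q v := by
    unfold so; rw [← add_sum_erase _ _ h]; simp
  have e2 : sb G (Q.erase v) v = sb G Q v := by
    unfold sb; rw [← add_sum_erase _ _ h]; simp
  have e3 : so G (Q.erase v)ᶜ v = so G Qᶜ v := by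
    unfold so; rw [e, sum_insert hv]; simp
  have e4 : sb G (Q.erase v)ᶜ v = sb G Qᶜ v := by
    unfold sb; rw [e, sum_insert hv]; simp
  rw [e1, e2, e3, e4] at h1
  exact h1

/-- First part of `DD`. -/
lemma D1_nonneg (G : ColouredGraph V) (Q : Finset V) : 0 ≤ ∑ x ∈ Q, ∑ y, rr G x y :=
  sum_nonneg fun _ _ => sum_nonneg fun _ _ => rr_nonneg _ _ _
lemma D2_nonneg (G : ColouredGraph V) (Q : Finset V) : 0 ≤ ∑ x ∈ Q, ∑ y ∈ Qᶜ, bb G x y :=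
  sum_nonneg fun _ _ => sum_nonneg fun _ _ => bb_nonneg _ _ _
lemma DD_nonneg (G : ColouredGraph V) (Q : Finset V) : 0 ≤ DD G Q :=
  add_nonneg (D1_nonneg G Q) (D2_nonneg G Q)

lemma trip_le3 (p q b : ℝ) (hp : 0 ≤ p) (hp1 : p ≤ 1) (hq : 0 ≤ q) (hq1 : q ≤ 1) (hb : 0 ≤ b)
    (hb1 : b ≤ 1) : 0 ≤ p * q * b ∧ p * q * b ≤ b ∧ p * q * b ≤ p ∧ p * q * b ≤ q ∧
      p * q * b ≤ p * q ∧ p * q * b ≤ p * b ∧ p * q * b ≤ 1 := by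
  have a1 : p * q ≤ 1 := mul_le_one₀ hp1 hq hq1
  have a2 : 0 ≤ p * q := by positivity
  have a3 : p * q ≤ p := mul_le_of_le_one_right hp hq1
  have a4 : p * q ≤ q := mul_le_of_le_one_left hq hp1
  have a5 : p * q * b ≤ p * q := mul_le_of_le_one_right a2 hb1
  refine ⟨by positivity, mul_le_of_le_one_left hb a1, by linarith, by linarith, a5, ?_, by linarith⟩
  exact mul_le_mul_of_nonneg_right a3 hb

lemma tripG (G : ColouredGraph V) (x y x' z y' z' : V) :
    0 ≤ rr G x y * rr G x' z * bb G y' z' ∧ rr G x y * rr G x' z * bb G y' z' ≤ bb G y' z' ∧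
    rr G x y * rr G x' z * bb G y' z' ≤ rr G x y ∧ rr G x y * rr G x' z * bb G y' z' ≤ rr G x' z ∧
    rr G x y * rr G x' z * bb G y' z' ≤ rr G x y * rr G x' z ∧
    rr G x y * rr G x' z * bb G y' z' ≤ rr G x y * bb G y' z' ∧
    rr G x y * rr G x' z * bb G y' z' ≤ 1 :=
  trip_le3 (rr G x y) (rr G x' z) (bb G y' z') (rr_nonneg _ _ _) (rr_le_one _ _ _) (rr_nonneg _ _ _)
    (rr_le_one _ _ _) (bb_nonneg _ _ _) (bb_le_one _ _ _)

lemma S3_Q_le (G : ColouredGraph V) (Q A B : Finset V) :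
    S3 G Q A B ≤ (Fintype.card V : ℝ) * ∑ x ∈ Q, ∑ y, rr G x y := by
  unfold S3
  rw [mul_sum]
  refine sum_le_sum fun x _ => ?_
  calc _ ≤ ∑ y ∈ A, ∑ z ∈ B, rr G x y :=
        sum_le_sum fun y _ => sum_le_sum fun z _ => (tripG G x y x z y z).2.2.1
    _ = ∑ y ∈ A, (B.card : ℝ) * rr G x y := by simp
    _ ≤ ∑ y ∈ A, (Fintype.card V : ℝ) * rr G x y := by
        refine sum_le_sum fun y _ => mul_le_mul_of_nonneg_right ?_ (rr_nonneg _ _ _)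
        exact_mod_cast card_le_univ B
    _ ≤ _ := by
        rw [← mul_sum]
        refine mul_le_mul_of_nonneg_left ?_ (by positivity)
        exact sum_le_sum_of_subset_of_nonneg (subset_univ _) fun _ _ _ => rr_nonneg _ _ _

lemma c2_bound (G : ColouredGraph V) (Q : Finset V) :
    c2 G ≤ (Qᶜ.card : ℝ) * (Q.card : ℝ) ^ 2 + 2 * alp * (Qᶜ.card : ℝ) ^ 3
      + 4 * (Fintype.card V : ℝ) * DD G Q := by
  rw [c2_split G Q]
  have h1 : S3 G Qᶜ Q Q ≤ (Qᶜ.card : ℝ) * (Q.card : ℝ) ^ 2 := by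
    unfold S3
    calc _ ≤ ∑ x ∈ Qᶜ, ∑ y ∈ Q, ∑ z ∈ Q, (1 : ℝ) :=
          sum_le_sum fun x _ => sum_le_sum fun y _ => sum_le_sum fun z _ =>
            (tripG G x y x z y z).2.2.2.2.2.2
      _ = _ := by simp only [sum_const, nsmul_eq_mul]; ring
  have h2 := (S3_le_f G Qᶜ).trans (mul_le_mul_of_nonneg_left (f_upper _) (by norm_num))
  have h3 : S3 G Qᶜ Q Qᶜ ≤ (Fintype.card V : ℝ) * ∑ x ∈ Q, ∑ y ∈ Qᶜ, bb G x y := by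
    unfold S3
    calc _ ≤ ∑ x ∈ Qᶜ, ∑ y ∈ Q, ∑ z ∈ Qᶜ, bb G y z :=
          sum_le_sum fun x _ => sum_le_sum fun y _ => sum_le_sum fun z _ =>
            (tripG G x y x z y z).2.1
      _ = (Qᶜ.card : ℝ) * ∑ x ∈ Q, ∑ y ∈ Qᶜ, bb G x y := by rw [sum_const, nsmul_eq_mul]
      _ ≤ _ := by
        refine mul_le_mul_of_nonneg_right ?_ (D2_nonneg G Q)
        exact_mod_cast card_le_univ _
  have h4 := S3_Q_le G Q Q Q
  have h5 := S3_Q_le G Q Q Qᶜ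
  have h6 := S3_Q_le G Q Qᶜ Qᶜ
  have h7 := mul_nonneg (Nat.cast_nonneg (α := ℝ) (Fintype.card V)) (D2_nonneg G Q)
  unfold DD
  linarith

/-- The part of `dv` living in the complement of `Q`. -/
noncomputable def cR (G : ColouredGraph V) (R : Finset V) (v : V) : ℝ :=
  ∑ y ∈ R, ∑ z ∈ R, rr G v y * rr G v z * bb G y z
    + 2 * ∑ x ∈ R, ∑ z ∈ R, rr G x v * rr G x z * bb G v z

lemma cR_le (G : ColouredGraph V) (R : Finset V) (v : V) :
    cR G R v ≤ so G R v ^ 2 + 2 * (si G R v * sb G R v) := by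
  unfold cR so si sb
  rw [sq, sum_mul_sum, sum_mul_sum]
  refine add_le_add ?_ (mul_le_mul_of_nonneg_left ?_ (by norm_num))
  · exact sum_le_sum fun y _ => sum_le_sum fun z _ => (tripG G v y v z y z).2.2.2.2.1
  · exact sum_le_sum fun y _ => sum_le_sum fun z _ => (tripG G y v y z v z).2.2.2.2.2.1

lemma dv_le (G : ColouredGraph V) (Q : Finset V) (v : V) :
    dv G v ≤ so G Q v ^ 2 + 2 * (si G Qᶜ v * sb G Q v) + cR G Qᶜ v + 4 * DD G Q := by
  have e : dv G v = (∑ y ∈ Q, ∑ z ∈ Q, rr G v y * rr G v z * bb G y z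
      + ∑ y ∈ Q, ∑ z ∈ Qᶜ, rr G v y * rr G v z * bb G y z
      + ∑ y ∈ Qᶜ, ∑ z ∈ Q, rr G v y * rr G v z * bb G y z)
      + 2 * (∑ x ∈ Qᶜ, ∑ z ∈ Q, rr G x v * rr G x z * bb G v z
        + ∑ x ∈ Q, ∑ z, rr G x v * rr G x z * bb G v z) + cR G Qᶜ v := by
    unfold dv cR
    simp only [sum_split Q, sum_add_distrib]
    ring
  have h1 : ∑ y ∈ Q, ∑ z ∈ Q, rr G v y * rr G v z * bb G y z ≤ so G Q v ^ 2 := by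
    unfold so
    rw [sq, sum_mul_sum]
    exact sum_le_sum fun y _ => sum_le_sum fun z _ => (tripG G v y v z y z).2.2.2.2.1
  have h2 : ∑ y ∈ Q, ∑ z ∈ Qᶜ, rr G v y * rr G v z * bb G y z ≤ ∑ x ∈ Q, ∑ y ∈ Qᶜ, bb G x y :=
    sum_le_sum fun y _ => sum_le_sum fun z _ => (tripG G v y v z y z).2.1
  have h3 : ∑ y ∈ Qᶜ, ∑ z ∈ Q, rr G v y * rr G v z * bb G y z ≤ ∑ x ∈ Q, ∑ y ∈ Qᶜ, bb G x y := by
    rw [sum_comm]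
    refine sum_le_sum fun y _ => sum_le_sum fun z _ => ?_
    rw [bb_comm G y z]
    exact (tripG G v z v y z y).2.1
  have h4 : ∑ x ∈ Qᶜ, ∑ z ∈ Q, rr G x v * rr G x z * bb G v z ≤ si G Qᶜ v * sb G Q v := by
    unfold si sb
    rw [sum_mul_sum]
    exact sum_le_sum fun y _ => sum_le_sum fun z _ => (tripG G y v y z v z).2.2.2.2.2.1
  have h5 : ∑ x ∈ Q, ∑ z, rr G x v * rr G x z * bb G v z ≤ ∑ x ∈ Q, ∑ y, rr G x y :=
    sum_le_sum fun y _ => sum_le_sum fun z _ => (tripG G y v y z v z).2.2.2.1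
  have h6 := D1_nonneg G Q
  have h7 := D2_nonneg G Q
  rw [e]
  unfold DD
  linarith

/-- Almost all pairs between the complement and `Q` are red towards `Q`. -/
lemma cross_ge (G : ColouredGraph V) (Q : Finset V) :
    (Qᶜ.card : ℝ) * Q.card - DD G Q ≤ ∑ x ∈ Qᶜ, ∑ z ∈ Q, rr G x z := by
  have e : ∑ x ∈ Qᶜ, ∑ z ∈ Q, rr G x z + (∑ x ∈ Q, ∑ y ∈ Qᶜ, rr G x y + ∑ x ∈ Q, ∑ y ∈ Qᶜ, bb G x y)
      = (Qᶜ.card : ℝ) * Q.card := by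
    rw [sum_comm, ← sum_add_distrib, ← sum_add_distrib]
    calc _ = ∑ x ∈ Q, ∑ y ∈ Qᶜ, (1 : ℝ) := by
          refine sum_congr rfl fun x hx => ?_
          rw [← sum_add_distrib, ← sum_add_distrib]
          refine sum_congr rfl fun y hy => ?_
          have : x ≠ y := by rintro rfl; simp [hx] at hy
          linarith [tri G this]
      _ = _ := by simp; ring
  have h : ∑ x ∈ Q, ∑ y ∈ Qᶜ, rr G x y ≤ ∑ x ∈ Q, ∑ y, rr G x y :=
    sum_le_sum fun x _ => sum_le_sum_of_subset_of_nonneg (subset_univ _) fun _ _ _ => rr_nonneg _ _ _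
  unfold DD
  linarith

lemma inner_ge (G : ColouredGraph V) (Q : Finset V) :
    (Q.card : ℝ) ^ 2 - Q.card - 2 * DD G Q ≤ ∑ x ∈ Q, ∑ z ∈ Q, bb G x z := by
  have e : ∑ x ∈ Q, ∑ z ∈ Q, bb G x z + (∑ x ∈ Q, ∑ y ∈ Q, rr G x y + ∑ x ∈ Q, ∑ y ∈ Q, rr G x y)
      = (Q.card : ℝ) ^ 2 - Q.card := by
    conv_lhs => enter [2, 2]; rw [sum_comm]
    rw [← sum_add_distrib, ← sum_add_distrib]
    calc _ = ∑ x ∈ Q, ((∑ y ∈ Q, (1 : ℝ)) - 1) := by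
          refine sum_congr rfl fun x hx => ?_
          rw [← sum_add_distrib, ← sum_add_distrib, ← add_sum_erase _ _ hx, ← add_sum_erase Q (fun _ => (1:ℝ)) hx]
          simp only [rr_self, bb_self]
          rw [sum_congr rfl (g := fun _ => (1 : ℝ))]
          · ring
          · intro y hy
            have : x ≠ y := (ne_of_mem_erase hy).symm
            linarith [tri G this]
      _ = _ := by simp; ring
  have h : ∑ x ∈ Q, ∑ y ∈ Q, rr G x y ≤ ∑ x ∈ Q, ∑ y, rr G x y :=
    sum_le_sum fun x _ => sum_le_sum_of_subset_of_nonneg (subset_univ _) fun _ _ _ => rr_nonneg _ _ _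
  have := D2_nonneg G Q
  unfold DD
  linarith

/-- Moving a vertex of `Q` to its ideal profile. -/
lemma moveA (G : ColouredGraph V) (Q : Finset V) (v : V) (hv : v ∈ Q) :
    ∃ p : V → Col, 2 * ((Qᶜ.card : ℝ) * Q.card - Qᶜ.card - DD G Q) ≤ dv (upd G v p) v := by
  classical
  refine ⟨fun y => if y ∈ Q then Col.blue else Col.inn, ?_⟩
  set p : V → Col := fun y => if y ∈ Q then Col.blue else Col.inn with hp
  set H := upd G v p with hH
  have h1 : ∑ x ∈ Qᶜ, ∑ z ∈ Q, rr G x z - Qᶜ.card ≤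
      ∑ x ∈ Qᶜ, ∑ z ∈ Q, rr H x v * rr H x z * bb H v z := by
    rw [show (Qᶜ.card : ℝ) = ∑ x ∈ Qᶜ, (1 : ℝ) by simp, ← sum_sub_distrib]
    refine sum_le_sum fun x hx => ?_
    have hxQ : x ∉ Q := by simpa using hx
    have hxv : x ≠ v := by rintro rfl; exact hxQ hv
    rw [← add_sum_erase _ _ hv, ← add_sum_erase (s := Q) (a := v) _ hv]
    have e : ∑ z ∈ Q.erase v, rr H x v * rr H x z * bb H v z = ∑ z ∈ Q.erase v, rr G x z := by
      refine sum_congr rfl fun z hz => ?_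
      have hzv := ne_of_mem_erase hz
      have hzQ := mem_of_mem_erase hz
      rw [(upd_inn G (p := p) hxv (by simp [hp, hxQ])).2.2.2, (upd_blue G (p := p) hzv (by simp [hp, hzQ])).1,
        upd_rr_ne G p hxv hzv]
      ring
    rw [e, bb_self]
    linarith [rr_le_one G x v]
  have h2 : ∑ x ∈ Qᶜ, ∑ z ∈ Q, rr H x v * rr H x z * bb H v z ≤
      ∑ x, ∑ z, rr H x v * rr H x z * bb H v z := by
    calc _ ≤ ∑ x ∈ Qᶜ, ∑ z, rr H x v * rr H x z * bb H v z :=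
          sum_le_sum fun x _ => sum_le_sum_of_subset_of_nonneg (subset_univ _)
            fun z _ _ => (tripG H x v x z v z).1
      _ ≤ _ := sum_le_sum_of_subset_of_nonneg (subset_univ _)
            fun x _ _ => sum_nonneg fun z _ => (tripG H x v x z v z).1
  have h3 : 0 ≤ ∑ y, ∑ z, rr H v y * rr H v z * bb H y z :=
    sum_nonneg fun y _ => sum_nonneg fun z _ => (tripG H v y v z y z).1
  have h4 := cross_ge G Q
  unfold dv
  linarith

/-- Moving a vertex outside `Q` to send red edges to all of `Q`. -/
lemma moveB (G : ColouredGraph V) (Q : Finset V) (v : V) (hv : v ∉ Q) :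
    ∃ p : V → Col, (Q.card : ℝ) ^ 2 - Q.card - 2 * DD G Q + cR G Qᶜ v ≤ dv (upd G v p) v := by
  classical
  refine ⟨fun y => if y ∈ Q then Col.out else prof G v y, ?_⟩
  set p : V → Col := fun y => if y ∈ Q then Col.out else prof G v y with hp
  set H := upd G v p with hH
  have hne : ∀ y ∈ Q, y ≠ v := by rintro y hy rfl; exact hv hy
  have e1 : ∑ y ∈ Q, ∑ z ∈ Q, rr H v y * rr H v z * bb H y z = ∑ y ∈ Q, ∑ z ∈ Q, bb G y z := by
    refine sum_congr rfl fun y hy => sum_congr rfl fun z hz => ?_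
    rw [(upd_out G (p := p) (hne y hy) (by simp [hp, hy])).2.2.1,
      (upd_out G (p := p) (hne z hz) (by simp [hp, hz])).2.2.1, upd_bb_ne G p (hne y hy) (hne z hz)]
    ring
  have pr : ∀ y ∈ Qᶜ, rr H v y = rr G v y ∧ rr H y v = rr G y v ∧ bb H v y = bb G v y := by
    intro y hy
    have hyQ : y ∉ Q := by simpa using hy
    by_cases h : y = v
    · subst h; simp
    · have := upd_prof G (p := p) h h (by simp [hp, hyQ])
      exact ⟨this.2.2.1, this.2.2.2, this.1⟩
  have e2 : cR H Qᶜ v = cR G Qᶜ v := by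
    unfold cR
    congr 1
    · refine sum_congr rfl fun y hy => sum_congr rfl fun z hz => ?_
      rw [(pr y hy).1, (pr z hz).1]
      by_cases h1 : y = v
      · subst h1; simp
      by_cases h2 : z = v
      · subst h2; simp
      rw [upd_bb_ne G p h1 h2]
    · congr 1
      refine sum_congr rfl fun y hy => sum_congr rfl fun z hz => ?_
      rw [(pr y hy).2.1, (pr z hz).2.2]
      by_cases h1 : y = v
      · subst h1; simp
      by_cases h2 : z = v
      · subst h2; simp
      rw [upd_rr_ne G p h1 h2]
  have e : dv H v = (∑ y ∈ Q, ∑ z ∈ Q, rr H v y * rr H v z * bb H y z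
      + ∑ y ∈ Q, ∑ z ∈ Qᶜ, rr H v y * rr H v z * bb H y z
      + ∑ y ∈ Qᶜ, ∑ z ∈ Q, rr H v y * rr H v z * bb H y z)
      + 2 * (∑ x ∈ Qᶜ, ∑ z ∈ Q, rr H x v * rr H x z * bb H v z
        + ∑ x ∈ Q, ∑ z, rr H x v * rr H x z * bb H v z) + cR H Qᶜ v := by
    unfold dv cR
    simp only [sum_split Q, sum_add_distrib]
    ring
  have n1 : 0 ≤ ∑ y ∈ Q, ∑ z ∈ Qᶜ, rr H v y * rr H v z * bb H y z :=
    sum_nonneg fun y _ => sum_nonneg fun z _ => (tripG H v y v z y z).1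
  have n2 : 0 ≤ ∑ y ∈ Qᶜ, ∑ z ∈ Q, rr H v y * rr H v z * bb H y z :=
    sum_nonneg fun y _ => sum_nonneg fun z _ => (tripG H v y v z y z).1
  have n3 : 0 ≤ ∑ x ∈ Qᶜ, ∑ z ∈ Q, rr H x v * rr H x z * bb H v z :=
    sum_nonneg fun x _ => sum_nonneg fun z _ => (tripG H x v x z v z).1
  have n4 : 0 ≤ ∑ x ∈ Q, ∑ z, rr H x v * rr H x z * bb H v z :=
    sum_nonneg fun x _ => sum_nonneg fun z _ => (tripG H x v x z v z).1
  have := inner_ge G Q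
  rw [e, e1, e2]
  linarith

/-- Contribution of a single pair. -/
lemma dv_pair (G : ColouredGraph V) (u v : V) :
    dv G u = (∑ y ∈ {v}ᶜ, ∑ z ∈ {v}ᶜ, rr G u y * rr G u z * bb G y z
      + 2 * ∑ x ∈ {v}ᶜ, ∑ z ∈ {v}ᶜ, rr G x u * rr G x z * bb G u z)
      + 2 * rr G u v * ∑ w ∈ {v}ᶜ, rr G u w * bb G v w
      + 2 * rr G v u * ∑ w ∈ {v}ᶜ, rr G v w * bb G u w
      + 2 * bb G u v * ∑ w ∈ {v}ᶜ, rr G w u * rr G w v := by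
  have e1 : ∑ y ∈ ({v}ᶜ : Finset V), rr G u y * rr G u v * bb G y v
      = rr G u v * ∑ w ∈ {v}ᶜ, rr G u w * bb G v w := by
    rw [mul_sum]; refine sum_congr rfl fun y _ => ?_; rw [bb_comm G y v]; ring
  have e2 : ∑ z ∈ ({v}ᶜ : Finset V), rr G u v * rr G u z * bb G v z
      = rr G u v * ∑ w ∈ {v}ᶜ, rr G u w * bb G v w := by
    rw [mul_sum]; refine sum_congr rfl fun y _ => ?_; ring
  have e3 : ∑ z ∈ ({v}ᶜ : Finset V), rr G v u * rr G v z * bb G u z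
      = rr G v u * ∑ w ∈ {v}ᶜ, rr G v w * bb G u w := by
    rw [mul_sum]; refine sum_congr rfl fun y _ => ?_; ring
  have e4 : ∑ x ∈ ({v}ᶜ : Finset V), rr G x u * rr G x v * bb G u v
      = bb G u v * ∑ w ∈ {v}ᶜ, rr G w u * rr G w v := by
    rw [mul_sum]; refine sum_congr rfl fun y _ => ?_; ring
  unfold dv
  simp only [sum_split {v}, sum_add_distrib, sum_singleton, rr_self, bb_self]
  rw [e1, e2, e3, e4]
  ring

lemma pair_gain (G : ColouredGraph V) (u v : V) (huv : u ≠ v) (p : V → Col)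
    (hp : ∀ w, w ≠ u → w ≠ v → p w = prof G u w) :
    c2 (upd G u p) - c2 G =
      2 * (rr (upd G u p) u v - rr G u v) * ∑ w ∈ {v}ᶜ, rr G u w * bb G v w
      + 2 * (rr (upd G u p) v u - rr G v u) * ∑ w ∈ {v}ᶜ, rr G v w * bb G u w
      + 2 * (bb (upd G u p) u v - bb G u v) * ∑ w ∈ {v}ᶜ, rr G w u * rr G w v := by
  rw [c2_upd, dv_pair (upd G u p) u v, dv_pair G u v]
  set H := upd G u p with hH
  have pr : ∀ y ∈ ({v}ᶜ : Finset V), rr H u y = rr G u y ∧ rr H y u = rr G y u ∧ bb H u y = bb G u y := by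
    intro y hy
    have hyv : y ≠ v := by simpa using hy
    by_cases h : y = u
    · subst h; simp
    · have := upd_prof G (p := p) h h (hp y h hyv)
      exact ⟨this.2.2.1, this.2.2.2, this.1⟩
  have e1 : ∑ y ∈ ({v}ᶜ : Finset V), ∑ z ∈ {v}ᶜ, rr H u y * rr H u z * bb H y z
      = ∑ y ∈ {v}ᶜ, ∑ z ∈ {v}ᶜ, rr G u y * rr G u z * bb G y z := by
    refine sum_congr rfl fun y hy => sum_congr rfl fun z hz => ?_
    rw [(pr y hy).1, (pr z hz).1]
    by_cases h1 : y = u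
    · subst h1; simp
    by_cases h2 : z = u
    · subst h2; simp
    rw [upd_bb_ne G p h1 h2]
  have e2 : ∑ x ∈ ({v}ᶜ : Finset V), ∑ z ∈ {v}ᶜ, rr H x u * rr H x z * bb H u z
      = ∑ x ∈ {v}ᶜ, ∑ z ∈ {v}ᶜ, rr G x u * rr G x z * bb G u z := by
    refine sum_congr rfl fun y hy => sum_congr rfl fun z hz => ?_
    rw [(pr y hy).2.1, (pr z hz).2.2]
    by_cases h1 : y = u
    · subst h1; simp
    by_cases h2 : z = u
    · subst h2; simp
    rw [upd_rr_ne G p h1 h2]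
  have e3 : ∑ w ∈ ({v}ᶜ : Finset V), rr H u w * bb H v w = ∑ w ∈ {v}ᶜ, rr G u w * bb G v w := by
    refine sum_congr rfl fun y hy => ?_
    rw [(pr y hy).1]
    by_cases h1 : y = u
    · subst h1; simp
    rw [upd_bb_ne G p huv.symm h1]
  have e4 : ∑ w ∈ ({v}ᶜ : Finset V), rr H v w * bb H u w = ∑ w ∈ {v}ᶜ, rr G v w * bb G u w := by
    refine sum_congr rfl fun y hy => ?_
    rw [(pr y hy).2.2]
    by_cases h1 : y = u
    · subst h1; simp
    rw [upd_rr_ne G p huv.symm h1]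
  have e5 : ∑ w ∈ ({v}ᶜ : Finset V), rr H w u * rr H w v = ∑ w ∈ {v}ᶜ, rr G w u * rr G w v := by
    refine sum_congr rfl fun y hy => ?_
    rw [(pr y hy).2.1]
    by_cases h1 : y = u
    · subst h1; simp
    rw [upd_rr_ne G p h1 huv.symm]
  rw [e1, e2, e3, e4, e5]
  ring

end Local

section Numeric

lemma numA (q s t i o b : ℝ) (h1 : 0.62 ≤ q) (h2 : q ≤ 0.65)
    (ht : 0 ≤ t) (hi : 0 ≤ i) (ho : 0 ≤ o) (hb : 0 ≤ b) (hr : i + o + b = 1 - q)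
    (hst : s + t ≤ q) (hm : t + o + b ≤ s)
    (hF : (1 - q) * q - t ^ 2 / 2 - i * s - o ^ 2 / 2 - i * b ≤ 0.00016) :
    (q - s) + (1 - q - i) ≤ 0.01 := by
  obtain ⟨W, rfl⟩ : ∃ W, s = q - W := ⟨q - s, by ring⟩
  obtain ⟨e, rfl⟩ : ∃ e, o = e - b := ⟨o + b, by ring⟩
  obtain rfl : i = 1 - q - e := by linarith
  have he : 0 ≤ e := by linarith
  have hW : 0 ≤ W := by linarith
  have hWe : W + e ≤ 0.65 := by linarith
  have a1 : t ^ 2 ≤ W * ((q - e) / 2) := by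
    rw [sq]; exact mul_le_mul (by linarith) (by linarith) ht hW
  have a2 : (e - b) ^ 2 ≤ (e - b) * (1 - q) := by
    rw [sq]; exact mul_le_mul_of_nonneg_left (by linarith) ho
  have a3 : 0 ≤ e * b := mul_nonneg he hb
  have a4 : 0 ≤ (e - b) * (1 - q) := mul_nonneg ho (by linarith)
  have a5 : 0.24 * e ≤ e * (2 * q - 1) := by nlinarith
  have a6 : W * 0.1875 ≤ W * (1 - q - q / 4) := mul_le_mul_of_nonneg_left (by linarith) hW
  have a7 : 0.75 * (W * e) ≤ 0.1375 * W + 0.19 * e := by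
    nlinarith [mul_nonneg hW (sub_nonneg.2 hWe), mul_nonneg he (sub_nonneg.2 hWe), sq_nonneg (W - e),
      mul_nonneg hW he, sq_nonneg (W - e - 0.07)]
  have key : 0.05 * (W + e) ≤ 0.00016 := by linarith
  linarith

lemma numB (q s t i e : ℝ) (h1 : 0.62 ≤ q) (h2 : q ≤ 0.65)
    (ht : 0 ≤ t) (hs : 0 ≤ s) (hi : 0 ≤ i) (he : 0 ≤ e) (hr : i + e ≤ 1 - q)
    (hst : s + t ≤ q) (hm : s ≤ t + e)
    (hF : q ^ 2 / 2 - t ^ 2 / 2 - i * s ≤ 0.00016) :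
    q - t ≤ 0.01 := by
  suffices h : 0.025 * (q - t) ≤ q ^ 2 / 2 - t ^ 2 / 2 - i * s by linarith
  have b1 : i * s ≤ (1 - q - e) * s := mul_le_mul_of_nonneg_right (by linarith) hs
  have b2 : 0 ≤ e * s := mul_nonneg he hs
  by_cases c1 : s ≤ t
  · by_cases c2 : q - t ≤ t
    · have : (1 - q) * s ≤ (1 - q) * (q - t) := mul_le_mul_of_nonneg_left (by linarith) (by linarith)
      have : 0 ≤ (q - t) * ((q + t) / 2 - (1 - q) - 0.025) := mul_nonneg (by linarith) (by linarith)
      nlinarith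
    · have : (1 - q) * s ≤ (1 - q) * t := mul_le_mul_of_nonneg_left (by linarith) (by linarith)
      have : (1 - q) * t ≤ 0.38 * t := mul_le_mul_of_nonneg_right (by linarith) ht
      nlinarith [mul_nonneg ht (show 0 ≤ q - 2 * t by linarith)]
  · have c2 : s * (s - t) ≤ s * e := mul_le_mul_of_nonneg_left (by linarith) hs
    have c3 : i * s ≤ (1 - q + t) ^ 2 / 4 := by nlinarith [sq_nonneg (1 - q + t - 2 * s)]
    have c4 : (1 - q + t) ^ 2 ≤ (0.38 + t) ^ 2 := pow_le_pow_left₀ (by linarith) (by linarith) 2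
    nlinarith [mul_nonneg ht (show 0 ≤ q - 2 * t by linarith)]

end Numeric

section Typical

open Finset

set_option linter.unusedSectionVars false

variable {V : Type} [Fintype V] [DecidableEq V]

lemma typA (G : ColouredGraph V) (Q : Finset V) (n : ℝ) (hn : n = Fintype.card V) (hn6 : 1000000 ≤ n)
    (hE : ∀ H, c2 H ≤ c2 G + 0.0001 * n * dd G H) (hD : DD G Q ≤ 0.000015 * n ^ 2)
    (hq1 : 0.62 * n ≤ Q.card) (hq2 : Q.card ≤ 0.65 * n) (v : V) (hv : v ∈ Q)
    (hm : so G Q v + so G Qᶜ v + sb G Qᶜ v ≤ sb G Q v) :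
    ((Q.card : ℝ) - sb G Q v) + (n - Q.card - si G Qᶜ v) ≤ 0.01 * n := by
  obtain ⟨p, hp⟩ := moveA G Q v hv
  have h1 := c2_upd G v p
  have h2 := hE (upd G v p)
  have h3 := dd_upd G v p
  have h4 := dv_le G Q v
  have h5 := cR_le G Qᶜ v
  have d1 := deg_sum_ne G Qᶜ v (by simpa using hv)
  have d2 := deg_sum_le G Q v
  have hr : (Qᶜ.card : ℝ) = n - Q.card := by rw [card_real_compl, hn]
  have n0 : 0 < n := by linarith
  rw [← hn] at h3
  rw [hr] at hp d1
  have x1 := so_nonneg G Q v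
  have x2 := si_nonneg G Q v
  have x3 := si_nonneg G Qᶜ v
  have x4 := so_nonneg G Qᶜ v
  have x5 := sb_nonneg G Qᶜ v
  set q : ℝ := (Q.card : ℝ)
  set t := so G Q v
  set s := sb G Q v
  set i := si G Qᶜ v
  set o := so G Qᶜ v
  set b := sb G Qᶜ v
  have h6 : 0.0001 * n * dd G (upd G v p) ≤ 0.0001 * n * (2 * n) :=
    mul_le_mul_of_nonneg_left h3 (by positivity)
  have h7 : n * 1000000 ≤ n * n := mul_le_mul_of_nonneg_left hn6 n0.le
  have hF : (n - q) * q - t ^ 2 / 2 - i * s - o ^ 2 / 2 - i * b ≤ 0.00016 * n ^ 2 := by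
    nlinarith
  have := numA (q / n) (s / n) (t / n) (i / n) (o / n) (b / n) (by rwa [le_div_iff₀ n0])
    (by rwa [div_le_iff₀ n0]) (by positivity) (by positivity) (by positivity) (by positivity)
    (by field_simp; linarith) (by rw [← add_div]; gcongr; linarith)
    (by rw [← add_div, ← add_div]; gcongr)
    (by
      have e : (1 - q / n) * (q / n) - (t / n) ^ 2 / 2 - i / n * (s / n) - (o / n) ^ 2 / 2
          - i / n * (b / n)
          = ((n - q) * q - t ^ 2 / 2 - i * s - o ^ 2 / 2 - i * b) / n ^ 2 := by
        field_simp
      rw [e, div_le_iff₀ (by positivity)]; exact hF)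
  have e : q / n - s / n + (1 - q / n - i / n) = (q - s + (n - q - i)) / n := by
    field_simp
  rw [e, div_le_iff₀ n0] at this
  exact this

lemma typB (G : ColouredGraph V) (Q : Finset V) (n : ℝ) (hn : n = Fintype.card V) (hn6 : 1000000 ≤ n)
    (hE : ∀ H, c2 H ≤ c2 G + 0.0001 * n * dd G H) (hD : DD G Q ≤ 0.000015 * n ^ 2)
    (hq1 : 0.62 * n ≤ Q.card) (hq2 : Q.card ≤ 0.65 * n) (v : V) (hv : v ∉ Q)
    (hm : sb G Q v ≤ so G Q v + so G Qᶜ v + sb G Qᶜ v) :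
    (Q.card : ℝ) - so G Q v ≤ 0.01 * n := by
  obtain ⟨p, hp⟩ := moveB G Q v hv
  have h1 := c2_upd G v p
  have h2 := hE (upd G v p)
  have h3 := dd_upd G v p
  have h4 := dv_le G Q v
  have d1 := deg_sum_le G Qᶜ v
  have d2 := deg_sum_le G Q v
  have hr : (Qᶜ.card : ℝ) = n - Q.card := by rw [card_real_compl, hn]
  have n0 : 0 < n := by linarith
  rw [← hn] at h3
  rw [hr] at d1
  have x1 := so_nonneg G Q v
  have x2 := si_nonneg G Q v
  have x3 := si_nonneg G Qᶜ v
  have x4 := so_nonneg G Qᶜ v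
  have x5 := sb_nonneg G Qᶜ v
  have x6 := sb_nonneg G Q v
  set q : ℝ := (Q.card : ℝ)
  set t := so G Q v
  set s := sb G Q v
  set i := si G Qᶜ v
  set o := so G Qᶜ v
  set b := sb G Qᶜ v
  have h6 : 0.0001 * n * dd G (upd G v p) ≤ 0.0001 * n * (2 * n) :=
    mul_le_mul_of_nonneg_left h3 (by positivity)
  have h7 : n * 1000000 ≤ n * n := mul_le_mul_of_nonneg_left hn6 n0.le
  have hF : q ^ 2 / 2 - t ^ 2 / 2 - i * s ≤ 0.00016 * n ^ 2 := by
    nlinarith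
  have := numB (q / n) (s / n) (t / n) (i / n) ((o + b) / n) (by rwa [le_div_iff₀ n0])
    (by rwa [div_le_iff₀ n0]) (by positivity) (by positivity) (by positivity) (by positivity)
    (by
      rw [← add_div, div_le_iff₀ n0]
      have : (1 - q / n) * n = n - q := by field_simp
      rw [this]; linarith)
    (by rw [← add_div]; gcongr; linarith)
    (by rw [← add_div]; gcongr; linarith)
    (by
      have e : (q / n) ^ 2 / 2 - (t / n) ^ 2 / 2 - i / n * (s / n)
          = (q ^ 2 / 2 - t ^ 2 / 2 - i * s) / n ^ 2 := by
        field_simp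
      rw [e, div_le_iff₀ (by positivity)]; exact hF)
  rw [← sub_div, div_le_iff₀ n0] at this
  exact this

/-- Lower bound for common neighbourhood type sums. -/
lemma prod_sum_ge (A B : Finset V) (hAB : A ⊆ B) (F K : V → ℝ) (hF : ∀ x, 0 ≤ F x ∧ F x ≤ 1)
    (hK : ∀ x, 0 ≤ K x ∧ K x ≤ 1) :
    ∑ x ∈ A, F x + ∑ x ∈ A, K x - A.card ≤ ∑ x ∈ B, F x * K x := by
  calc _ = ∑ x ∈ A, (F x + K x - 1) := by simp [sum_add_distrib]
    _ ≤ ∑ x ∈ A, F x * K x := sum_le_sum fun x _ => by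
        nlinarith [mul_nonneg (sub_nonneg.2 (hF x).2) (sub_nonneg.2 (hK x).2)]
    _ ≤ _ := sum_le_sum_of_subset_of_nonneg hAB fun x _ _ => mul_nonneg (hF x).1 (hK x).1

lemma prod_sum_le (B : Finset V) (F K : V → ℝ) (hF : ∀ x, 0 ≤ F x ∧ F x ≤ 1)
    (hK : ∀ x, 0 ≤ K x ∧ K x ≤ 1) : ∑ x ∈ B, F x * K x ≤ ∑ x, F x := by
  calc _ ≤ ∑ x ∈ B, F x := sum_le_sum fun x _ => mul_le_of_le_one_right (hF x).1 (hK x).2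
    _ ≤ _ := sum_le_sum_of_subset_of_nonneg (subset_univ _) fun x _ _ => (hF x).1

lemma no_bad (G : ColouredGraph V) (Q : Finset V) (n : ℝ) (hn : n = Fintype.card V) (hn6 : 1000000 ≤ n)
    (hE : ∀ H, c2 H ≤ c2 G + 0.0001 * n * dd G H)
    (hq1 : 0.62 * n ≤ Q.card) (hq2 : Q.card ≤ 0.65 * n)
    (hA : ∀ v ∈ Q, ((Q.card : ℝ) - sb G Q v) + (n - Q.card - si G Qᶜ v) ≤ 0.01 * n)
    (hB : ∀ v, v ∉ Q → (Q.card : ℝ) - so G Q v ≤ 0.01 * n) :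
    DD G Q = 0 := by
  classical
  have n0 : 0 < n := by linarith
  have hr : (Qᶜ.card : ℝ) = n - Q.card := by rw [card_real_compl, hn]
  have r01 : ∀ x y, 0 ≤ rr G x y ∧ rr G x y ≤ 1 := fun x y => ⟨rr_nonneg _ _ _, rr_le_one _ _ _⟩
  have b01 : ∀ x y, 0 ≤ bb G x y ∧ bb G x y ≤ 1 := fun x y => ⟨bb_nonneg _ _ _, bb_le_one _ _ _⟩
  have outd : ∀ u ∈ Q, ∑ w, rr G u w ≤ 0.01 * n := by
    intro u hu
    have := hA u hu
    have d1 := deg_sum_ne G Qᶜ u (by simpa using hu)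
    have d2 := deg_sum_le G Q u
    rw [sum_split Q]
    have x2 := si_nonneg G Q u
    have x5 := sb_nonneg G Qᶜ u
    change so G Q u + so G Qᶜ u ≤ _
    linarith
  have ind : ∀ u ∈ Q, ∑ w, rr G w u ≤ n - Q.card + 0.01 * n := by
    intro u hu
    have := hA u hu
    have d1 := deg_sum_ne G Qᶜ u (by simpa using hu)
    have d2 := deg_sum_le G Q u
    rw [sum_split Q]
    have x2 := so_nonneg G Q u
    have x5 := sb_nonneg G Qᶜ u
    have x6 := so_nonneg G Qᶜ u
    change si G Q u + si G Qᶜ u ≤ _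
    linarith
  have gen : ∀ u v, u ≠ v → ∀ c : Col,
      2 * (rr (upd G u (fun w => if w = v then c else prof G u w)) u v - rr G u v)
          * ∑ w ∈ {v}ᶜ, rr G u w * bb G v w
      + 2 * (rr (upd G u (fun w => if w = v then c else prof G u w)) v u - rr G v u)
          * ∑ w ∈ {v}ᶜ, rr G v w * bb G u w
      + 2 * (bb (upd G u (fun w => if w = v then c else prof G u w)) u v - bb G u v)
          * ∑ w ∈ {v}ᶜ, rr G w u * rr G w v ≤ 0.0002 * n := by
    intro u v huv c
    have hp : ∀ w, w ≠ u → w ≠ v → (fun w => if w = v then c else prof G u w) w = prof G u w := by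
      intro w _ hw; simp [hw]
    rw [← pair_gain G u v huv _ hp]
    have h1 := dd_upd_pair G u v _ huv hp
    have h2 := hE (upd G u (fun w => if w = v then c else prof G u w))
    have h3 := mul_le_mul_of_nonneg_left h1 (show 0 ≤ 0.0001 * n by positivity)
    linarith
  -- common lower bound for vertices outside
  have comB : ∀ u ∈ Q, ∀ v, v ∉ Q → (Q.card : ℝ) - 0.02 * n ≤ ∑ w ∈ ({v}ᶜ : Finset V), rr G v w * bb G u w := by
    intro u hu v hv
    have h1 := prod_sum_ge Q {v}ᶜ (by intro x hx; simp; rintro rfl; exact hv hx) (fun w => rr G v w)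
      (fun w => bb G u w) (r01 v) (b01 u)
    have h2 := hA u hu
    have h3 := hB v hv
    have d1 := deg_sum_ne G Qᶜ u (by simpa using hu)
    have x5 := sb_nonneg G Qᶜ u
    have x6 := so_nonneg G Qᶜ u
    change so G Q v + sb G Q u - _ ≤ _ at h1
    linarith
  have R0 : ∀ u ∈ Q, ∀ v, rr G u v = 0 := by
    intro u hu v
    rcases rr_zero_or_one G u v with h | h
    · exact h
    exfalso
    have huv : u ≠ v := by rintro rfl; simp at h
    have t := tri G huv
    have z1 : bb G u v = 0 := by linarith [bb_nonneg G u v, rr_nonneg G v u]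
    have z2 : rr G v u = 0 := by linarith [bb_nonneg G u v, rr_nonneg G v u]
    have hAle := (prod_sum_le {v}ᶜ (fun w => rr G u w) (fun w => bb G v w) (r01 u) (b01 v)).trans (outd u hu)
    by_cases hv : v ∈ Q
    · have g := gen u v huv Col.blue
      have e := upd_blue G (p := fun w => if w = v then Col.blue else prof G u w) huv.symm (by simp)
      rw [e.1, e.2.2.1, e.2.2.2, h, z1, z2] at g
      have h1 := prod_sum_ge Qᶜ {v}ᶜ (by intro x hx; simp; rintro rfl; simp [hv] at hx)
        (fun w => rr G w u) (fun w => rr G w v) (fun w => r01 w u) (fun w => r01 w v)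
      have h2 := hA u hu
      have h3 := hA v hv
      have d1 := deg_sum_le G Q u
      have d2 := deg_sum_le G Q v
      have x1 := si_nonneg G Q u
      have x2 := so_nonneg G Q u
      have x3 := si_nonneg G Q v
      have x4 := so_nonneg G Q v
      change si G Qᶜ u + si G Qᶜ v - _ ≤ _ at h1
      linarith
    · have g := gen u v huv Col.inn
      have e := upd_inn G (p := fun w => if w = v then Col.inn else prof G u w) huv.symm (by simp)
      rw [e.1, e.2.2.1, e.2.2.2, h, z1, z2] at g
      have := comB u hu v hv
      linarith
  have B0 : ∀ u ∈ Q, ∀ v ∈ Qᶜ, bb G u v = 0 := by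
    intro u hu v hv
    have hv : v ∉ Q := by simpa using hv
    rcases bb_zero_or_one G u v with h | h
    · exact h
    exfalso
    have huv : u ≠ v := by rintro rfl; simp at h
    have t := tri G huv
    have z1 : rr G u v = 0 := by linarith [rr_nonneg G u v, rr_nonneg G v u]
    have z2 : rr G v u = 0 := by linarith [rr_nonneg G u v, rr_nonneg G v u]
    have hCle := (prod_sum_le {v}ᶜ (fun w => rr G w u) (fun w => rr G w v) (fun w => r01 w u)
      (fun w => r01 w v)).trans (ind u hu)
    have g := gen u v huv Col.inn
    have e := upd_inn G (p := fun w => if w = v then Col.inn else prof G u w) huv.symm (by simp)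
    rw [e.1, e.2.2.1, e.2.2.2, h, z1, z2] at g
    have := comB u hu v hv
    linarith
  unfold DD
  rw [sum_eq_zero (fun x hx => sum_eq_zero fun y _ => R0 x hx y),
    sum_eq_zero (fun x hx => sum_eq_zero fun y hy => B0 x hx y hy)]
  ring

end Typical

section Assembly

open Finset

set_option linter.unusedSectionVars false

variable {V : Type} [Fintype V] [DecidableEq V]

lemma q_close (G : ColouredGraph V) (Q : Finset V) (n ε : ℝ) (hn : n = Fintype.card V) (hn0 : 0 < n)
    (hεn : 1 ≤ ε ^ 2 * n) (hc : 2 * alp * n ^ 3 - 2 * n ^ 2 - 2 * ε ^ 2 * n ^ 3 ≤ c2 G)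
    (hq : n / 2 ≤ Q.card) :
    ((Q.card : ℝ) - bet * n) ^ 2 ≤ 7 * ε ^ 2 * n ^ 2 + 7 * DD G Q := by
  have h1 := c2_bound G Q
  have hr : (Qᶜ.card : ℝ) = n - Q.card := by rw [card_real_compl, hn]
  rw [hr, ← hn] at h1
  set q : ℝ := (Q.card : ℝ)
  have g := g_identity q n
  have lo := sq3_lo
  have h2 : n ^ 2 * 1 ≤ n ^ 2 * (ε ^ 2 * n) := mul_le_mul_of_nonneg_left hεn (by positivity)
  have h3 : 0.577 * (n / 2) * (q - bet * n) ^ 2 ≤ Real.sqrt 3 / 3 * q * (q - bet * n) ^ 2 := by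
    refine mul_le_mul_of_nonneg_right ?_ (sq_nonneg _)
    exact mul_le_mul (by linarith) hq (by positivity) (by positivity)
  have h4 : n * (0.2885 * (q - bet * n) ^ 2) ≤ n * (2 * ε ^ 2 * n ^ 2 + 2 * DD G Q) := by linarith
  have h5 := le_of_mul_le_mul_left h4 hn0
  have h6 := DD_nonneg G Q
  have h7 : 0 ≤ ε ^ 2 * n ^ 2 := by positivity
  linarith

lemma local_lemma (G : ColouredGraph V) (n ε : ℝ) (hn : n = Fintype.card V) (hε : 0 < ε)
    (hε1 : ε < 0.00001) (hεn : 1 ≤ ε ^ 2 * n)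
    (hc : 2 * (f (Fintype.card V) : ℝ) - 2 * ε ^ 2 * n ^ 3 ≤ c2 G) (Q0 : Finset V)
    (hQ0 : n / 2 ≤ Q0.card) (hD0 : DD G Q0 ≤ 0.00001 * n ^ 2) :
    ∃ (G' : ColouredGraph V) (Q : Finset V), c2 G ≤ c2 G' ∧ dd G G' ≤ 20000 * ε ^ 2 * n ^ 2 ∧
      DD G' Q = 0 ∧ 0.62 * n ≤ Q.card ∧ |(Q.card : ℝ) - bet * n| ≤ 100 * ε * n := by
  classical
  have hε2 : ε ^ 2 ≤ 0.0000000001 := by nlinarith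
  have hn10 : 10000000000 ≤ n := by
    by_contra h
    push Not at h
    rcases le_or_gt n 0 with h0 | h0
    · nlinarith [sq_nonneg ε]
    · nlinarith [mul_le_mul_of_nonneg_right hε2 h0.le]
  have n0 : 0 < n := by linarith
  have : Finite (ColouredGraph V) := finite_cg
  have : Nonempty (ColouredGraph V) := ⟨G⟩
  obtain ⟨K, hK⟩ := Finite.exists_max (fun H : ColouredGraph V => c2 H - 0.0001 * n * dd G H)
  have k1 := hK G
  simp only [dd_self, mul_zero, sub_zero] at k1
  have k2 : 0 ≤ 0.0001 * n * dd G K := mul_nonneg (by positivity) (dd_nonneg G K)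
  have hE : ∀ H, c2 H ≤ c2 K + 0.0001 * n * dd K H := by
    intro H
    have h1 := hK H
    have h2 := mul_le_mul_of_nonneg_left (dd_triangle G K H) (show 0 ≤ 0.0001 * n by positivity)
    linarith
  have hf := c2_le_f (Fintype.card V) V K rfl
  have hdd : dd G K ≤ 20000 * ε ^ 2 * n ^ 2 := by
    have : n * (0.0001 * dd G K) ≤ n * (2 * ε ^ 2 * n ^ 2) := by linarith
    have := le_of_mul_le_mul_left this n0
    linarith
  have hn2 : 0 < n ^ 2 := by positivity
  have hdd2 : dd G K ≤ 0.000002 * n ^ 2 := by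
    have := mul_le_mul_of_nonneg_right hε2 hn2.le
    linarith
  have hDK : DD K Q0 ≤ 0.000012 * n ^ 2 := by
    have := DD_le K G Q0
    rw [dd_symm] at this
    linarith
  obtain ⟨Q, hQm, hQ⟩ := exists_min_image ((univ : Finset (Finset V)).filter fun Q => n / 2 ≤ Q.card)
    (fun Q => DD K Q) ⟨Q0, by simpa using hQ0⟩
  have hQ2 : n / 2 ≤ Q.card := by simpa using hQm
  have hQmin : ∀ P : Finset V, n / 2 ≤ P.card → DD K Q ≤ DD K P := fun P hP => hQ P (by simpa using hP)
  have hDQ : DD K Q ≤ 0.000012 * n ^ 2 := (hQmin Q0 hQ0).trans hDK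
  have hfl := f_lower (Fintype.card V)
  rw [← hn] at hfl
  have hcK : 2 * alp * n ^ 3 - 2 * n ^ 2 - 2 * ε ^ 2 * n ^ 3 ≤ c2 K := by linarith
  have hcl := q_close K Q n ε hn n0 hεn hcK hQ2
  have lo := sq3_lo
  have hi := sq3_hi
  have hb1 : 0.6339 < bet := by unfold bet; linarith
  have hb2 : bet < 0.6341 := by unfold bet; linarith
  have hab : |(Q.card : ℝ) - bet * n| ≤ 0.01 * n := by
    refine abs_le_of_sq_le_sq ?_ (by positivity)
    have := mul_le_mul_of_nonneg_right hε2 hn2.le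
    rw [mul_pow]
    linarith
  obtain ⟨a1, a2⟩ := abs_le.1 hab
  have hb1n : 0.6339 * n ≤ bet * n := mul_le_mul_of_nonneg_right hb1.le n0.le
  have hb2n : bet * n ≤ 0.6341 * n := mul_le_mul_of_nonneg_right hb2.le n0.le
  have q1 : 0.62 * n ≤ Q.card := by linarith
  have q2 : Q.card ≤ 0.65 * n := by linarith
  have hA : ∀ v ∈ Q, ((Q.card : ℝ) - sb K Q v) + (n - Q.card - si K Qᶜ v) ≤ 0.01 * n := by
    intro v hv
    refine typA K Q n hn (by linarith) hE (by linarith) q1 q2 v hv ?_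
    have h1 := DD_erase K Q v hv
    have h2 := hQmin (Q.erase v) (by
      have : ((Q.erase v).card : ℝ) + 1 = Q.card := by exact_mod_cast card_erase_add_one hv
      linarith)
    linarith
  have hB : ∀ v, v ∉ Q → (Q.card : ℝ) - so K Q v ≤ 0.01 * n := by
    intro v hv
    refine typB K Q n hn (by linarith) hE (by linarith) q1 q2 v hv ?_
    have h1 := DD_insert K Q v hv
    have h2 := hQmin (insert v Q) (by
      have : ((insert v Q).card : ℝ) = Q.card + 1 := by exact_mod_cast card_insert_of_notMem hv
      linarith)
    linarith
  have hD := no_bad K Q n hn (by linarith) hE q1 q2 hA hB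
  refine ⟨K, Q, by linarith, hdd, hD, q1, ?_⟩
  refine abs_le_of_sq_le_sq ?_ (by positivity)
  rw [hD] at hcl
  have : 0 ≤ ε ^ 2 * n ^ 2 := by positivity
  have e : (100 * ε * n) ^ 2 = 10000 * (ε ^ 2 * n ^ 2) := by ring
  rw [e]
  linarith

lemma path_lemma (G : ColouredGraph V) (n ε : ℝ) (hn : n = Fintype.card V) (hε : 0 < ε)
    (hε1 : ε < 0.00001) (hεn : 1 ≤ ε ^ 2 * n)
    (hc : 2 * (f (Fintype.card V) : ℝ) - 2 * ε ^ 2 * n ^ 3 ≤ c2 G) :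
    ∃ Q : Finset V, n / 2 ≤ Q.card ∧ DD G Q ≤ 0.000005 * n ^ 2 := by
  have hε2 : ε ^ 2 ≤ 0.0000000001 := by nlinarith
  have hn10 : 10000000000 ≤ n := by
    by_contra h
    push Not at h
    rcases le_or_gt n 0 with h0 | h0
    · nlinarith [sq_nonneg ε]
    · nlinarith [mul_le_mul_of_nonneg_right hε2 h0.le]
  have n0 : 0 < n := by linarith
  have hn2 : 0 < n ^ 2 := by positivity
  obtain ⟨H, hGH, hF⟩ := exists_fin G
  revert hc
  refine Relation.ReflTransGen.head_induction_on (motive := fun G _ =>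
    2 * (f (Fintype.card V) : ℝ) - 2 * ε ^ 2 * n ^ 3 ≤ c2 G →
      ∃ Q : Finset V, n / 2 ≤ Q.card ∧ DD G Q ≤ 0.000005 * n ^ 2) hGH ?_ ?_
  · intro hc
    have hfl := f_lower (Fintype.card V)
    have := fin_close H hF (0.0000000002) (by norm_num) (by
      have : (0 : ℝ) < Fintype.card V := by rw [← hn]; exact n0
      exact_mod_cast this) (by
      rw [← hn] at hfl ⊢
      have h1 := mul_le_mul_of_nonneg_right hε2 (show 0 ≤ n ^ 3 by positivity)
      have h2 := mul_le_mul_of_nonneg_right hn10 hn2.le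
      nlinarith)
    rw [← hn] at this
    exact this
  · intro a c hac _ ih hc
    obtain ⟨Q, hQ1, hQ2⟩ := ih (hc.trans hac.1)
    have h1 := DD_le a c Q
    have h2 := hac.2
    rw [← hn] at h2
    have h3 : n * 10000000000 ≤ n * n := mul_le_mul_of_nonneg_left hn10 n0.le
    obtain ⟨G', P, p1, p2, p3, p4, p5⟩ := local_lemma a n ε hn hε hε1 hεn hc Q hQ1 (by nlinarith)
    refine ⟨P, by linarith, ?_⟩
    have h4 := DD_le a G' P
    have := mul_le_mul_of_nonneg_right hε2 hn2.le
    linarith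

lemma diff_le (G H : ColouredGraph V) : ((diffPairs G H).ncard : ℝ) ≤ dd G H := by
  classical
  set T : Finset (V × V) := univ.filter fun p => p.1 ≠ p.2 ∧
    ¬ ((G.Blue p.1 p.2 ↔ H.Blue p.1 p.2) ∧ (G.Red p.1 p.2 ↔ H.Red p.1 p.2) ∧
      (G.Red p.2 p.1 ↔ H.Red p.2 p.1)) with hT
  have h1 : diffPairs G H ⊆ ((T.image fun p => ({p.1, p.2} : Finset V) : Finset (Finset V)) : Set (Finset V)) := by
    rintro e ⟨x, y, hxy, rfl, h⟩
    simp only [coe_image, Set.mem_image, mem_coe]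
    exact ⟨(x, y), by simp only [hT, mem_filter, mem_univ, true_and]; exact ⟨hxy, h⟩, rfl⟩
  have h2 : (diffPairs G H).ncard ≤ T.card := by
    refine (Set.ncard_le_ncard h1 (finite_toSet _)).trans ?_
    rw [Set.ncard_coe_finset]
    exact card_image_le
  have h3 : dd G H = T.card := by
    unfold dd
    rw [← Finset.sum_product', univ_product_univ, hT, card_filter]
    push_cast
    refine sum_congr rfl fun p _ => ?_
    unfold ddi
    by_cases h : p.1 ≠ p.2 ∧
      ¬ ((G.Blue p.1 p.2 ↔ H.Blue p.1 p.2) ∧ (G.Red p.1 p.2 ↔ H.Red p.1 p.2) ∧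
        (G.Red p.2 p.1 ↔ H.Red p.2 p.1))
    · rw [if_pos h]
    · rw [if_neg h]
  rw [h3]
  exact_mod_cast h2

lemma DD_zero_struct (G : ColouredGraph V) (Q : Finset V) (h : DD G Q = 0) :
    (∀ x ∈ Q, ∀ y ∈ Q, x ≠ y → G.Blue x y) ∧ (∀ q ∈ Q, ∀ v : V, v ∉ Q → G.Red v q) := by
  have h1 := D1_nonneg G Q
  have h2 := D2_nonneg G Q
  unfold DD at h
  have e1 : ∑ x ∈ Q, ∑ y, rr G x y = 0 := by linarith
  have e2 : ∑ x ∈ Q, ∑ y ∈ Qᶜ, bb G x y = 0 := by linarith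
  have R0 : ∀ x ∈ Q, ∀ y, rr G x y = 0 := by
    intro x hx y
    have a := (sum_eq_zero_iff_of_nonneg (fun x _ => sum_nonneg fun y _ => rr_nonneg G x y)).1 e1 x hx
    exact (sum_eq_zero_iff_of_nonneg (fun y _ => rr_nonneg G x y)).1 a y (mem_univ y)
  have B0 : ∀ x ∈ Q, ∀ y ∈ Qᶜ, bb G x y = 0 := by
    intro x hx y hy
    have a := (sum_eq_zero_iff_of_nonneg (fun x _ => sum_nonneg fun y _ => bb_nonneg G x y)).1 e2 x hx
    exact (sum_eq_zero_iff_of_nonneg (fun y _ => bb_nonneg G x y)).1 a y hy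
  constructor
  · intro x hx y hy hxy
    have t := tri G hxy
    rw [R0 x hx y, R0 y hy x] at t
    by_contra hb
    have : bb G x y = 0 := by unfold bb; rw [if_neg (fun h => hb h.2)]
    linarith
  · intro q hq v hv
    have hne : q ≠ v := by rintro rfl; exact hv hq
    have t := tri G hne
    rw [R0 q hq v, B0 q hq v (by simpa using hv)] at t
    by_contra hb
    have : rr G v q = 0 := by unfold rr; rw [if_neg (fun h => hb h.2)]
    linarith

end Assembly

/-- If `G` is a coloured graph on `n` vertices with `c(G) ≥ f(n) − ε²n³`, then there are a
coloured graph `G'` on the same vertex set and a set `Q` such that: `c(G') ≥ c(G)`;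
`G` and `G'` differ on at most `800·√ε·n²` pairs; `||Q| − βn| ≤ 100εn`; `Q` is a blue
clique in `G'`; and all other pairs meeting `Q` are red in `G'` and directed towards `Q`. -/
theorem stability_step :
    ∃ ε₀ : ℝ, 0 < ε₀ ∧ ∀ ε : ℝ, 0 < ε → ε < ε₀ →
      ∃ n₀ : ℕ, ∀ n : ℕ, n₀ ≤ n → ∀ G : ColouredGraph (Fin n),
        (cherryCount G : ℝ) ≥ (f n : ℝ) - ε ^ 2 * (n : ℝ) ^ 3 →
        ∃ G' : ColouredGraph (Fin n), ∃ Q : Finset (Fin n),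
          cherryCount G' ≥ cherryCount G ∧
          ((diffPairs G G').ncard : ℝ) ≤ 800 * Real.sqrt ε * (n : ℝ) ^ 2 ∧
          |(Q.card : ℝ) - (3 - Real.sqrt 3) / 2 * (n : ℝ)| ≤ 100 * ε * (n : ℝ) ∧
          (∀ x ∈ Q, ∀ y ∈ Q, x ≠ y → G'.Blue x y) ∧
          (∀ q ∈ Q, ∀ v : Fin n, v ∉ Q → G'.Red v q) := by
  refine ⟨0.00001, by norm_num, fun ε hε hε1 => ⟨⌈1 / ε ^ 2⌉₊, fun n hn G hc => ?_⟩⟩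
  have hcard : (n : ℝ) = (Fintype.card (Fin n) : ℝ) := by simp
  have hεp : 0 < ε ^ 2 := by positivity
  have hεn : 1 ≤ ε ^ 2 * (n : ℝ) := by
    have h1 : 1 / ε ^ 2 ≤ (n : ℝ) := (Nat.le_ceil _).trans (by exact_mod_cast hn)
    rw [div_le_iff₀ hεp] at h1
    linarith
  have hc2 : 2 * (f (Fintype.card (Fin n)) : ℝ) - 2 * ε ^ 2 * (n : ℝ) ^ 3 ≤ c2 G := by
    rw [c2_eq, Fintype.card_fin]
    linarith
  have hn2 : 0 ≤ (n : ℝ) ^ 2 := by positivity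
  obtain ⟨Q0, h1, h2⟩ := path_lemma G n ε hcard hε hε1 hεn hc2
  obtain ⟨G', Q, g1, g2, g3, -, g5⟩ := local_lemma G n ε hcard hε hε1 hεn hc2 Q0 h1 (by linarith)
  obtain ⟨s1, s2⟩ := DD_zero_struct G' Q g3
  refine ⟨G', Q, ?_, ?_, g5, s1, s2⟩
  · rw [c2_eq, c2_eq] at g1
    have : (cherryCount G : ℝ) ≤ cherryCount G' := by linarith
    exact_mod_cast this
  · refine (diff_le G G').trans (g2.trans (mul_le_mul_of_nonneg_right ?_ hn2))
    have a1 : ε ≤ Real.sqrt ε := Real.le_sqrt_of_sq_le (by nlinarith)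
    nlinarith
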